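/- arXiv:1003.0544 — 5 statements merged into one kernel-verified Lean document; each statement's English description precedes it below -/
import Mathlib

section
/- Let (R, m, k) be a Noetherian local ring and I an ideal of R. Then for every integer n ≥ 0, the alternating sum ∑_{j=0}^{2n+1} (-1)^{j+1} β_j^R(I) ≥ -1, where β_j^R(I) = dim_k Tor_j^R(k, I). In particular, β_1^R(I) - β_0^R(I) ≥ -1. -/
open CategoryTheory IsLocalRing RingTheory.Sequence

noncomputable section

variable (R : Type) [CommRing R]

/-- `Tor_n^R(M, N)` as an object of `ModuleCat R`. -/
def TorM (n : ℕ) (M N : ModuleCat R) : ModuleCat R :=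
  ((Tor (ModuleCat R) n).obj M).obj N

/-- `Ext_R^n(M, N)` as an object of `ModuleCat R`. -/
def ExtM (n : ℕ) (M N : ModuleCat R) : ModuleCat R :=
  ((Ext R (ModuleCat R) n).obj (Opposite.op M)).obj N

/-- `b` is the `j`-th Betti number of `M`, i.e. `Tor_j(k, M) ≅ k^b`. -/
def HasBetti [IsLocalRing R] (M : ModuleCat R) (j b : ℕ) : Prop :=
  Nonempty (TorM R j (ModuleCat.of R (ResidueField R)) M ≅
    ModuleCat.of R (Fin b → ResidueField R))

/-- `b` is the `j`-th Bass number of `M`, i.e. `Ext^j(k, M) ≅ k^b`. -/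
def HasBass [IsLocalRing R] (M : ModuleCat R) (j b : ℕ) : Prop :=
  Nonempty (ExtM R j (ModuleCat.of R (ResidueField R)) M ≅
    ModuleCat.of R (Fin b → ResidueField R))

/-- Projective dimension at most `n`: all `Ext^m(M, -)` vanish for `m > n`. -/
def ProjDimLE (M : ModuleCat R) (n : ℕ) : Prop :=
  ∀ m > n, ∀ N : ModuleCat R, Limits.IsZero (ExtM R m M N)

def ProjDimEq (M : ModuleCat R) (n : ℕ) : Prop :=
  ProjDimLE R M n ∧ ∀ m : ℕ, ProjDimLE R M m → n ≤ m

/-- The ideal `I` contains a regular sequence of length `g`. -/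
def GradeGE (I : Ideal R) (g : ℕ) : Prop :=
  ∃ rs : List R, rs.length = g ∧ (∀ x ∈ rs, x ∈ I) ∧ IsRegular R rs

/-- `grade I = g`. -/
def GradeEq (I : Ideal R) (g : ℕ) : Prop :=
  GradeGE R I g ∧ ∀ rs : List R, (∀ x ∈ rs, x ∈ I) → IsRegular R rs → rs.length ≤ g

/-- The height of a prime ideal, as the Krull dimension of the localization. -/
def primeHt (p : Ideal R) [p.IsPrime] : WithBot (WithTop ℕ) :=
  ringKrullDim (Localization.AtPrime p)

/-- The height of an ideal: the infimum of heights of minimal primes over it. -/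
def idealHt (I : Ideal R) : WithBot (WithTop ℕ) :=
  sInf { h | ∃ p : PrimeSpectrum R, p.asIdeal ∈ I.minimalPrimes ∧
    ringKrullDim (Localization.AtPrime p.asIdeal) = h }

/-- The `p`-primary component of `I` (contraction of the extension to `R_p`). -/
def primaryComponent (I p : Ideal R) [p.IsPrime] : Ideal R :=
  (I.map (algebraMap R (Localization.AtPrime p))).comap
    (algebraMap R (Localization.AtPrime p))

/-- The unmixed part of `I`: intersection of the primary components at the
minimal primes of minimal height. -/
def unmixedPart (I : Ideal R) : Ideal R :=
  ⨅ p : { p : PrimeSpectrum R // p.asIdeal ∈ I.minimalPrimes ∧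
      ringKrullDim (Localization.AtPrime p.asIdeal) = idealHt R I },
    primaryComponent R I p.1.asIdeal

/-- The quotient `R ⧸ J` is a Cohen-Macaulay module over the local ring `R`. -/
def IsCMQuot [IsLocalRing R] (J : Ideal R) : Prop :=
  ∃ rs : List R, (∀ x ∈ rs, x ∈ maximalIdeal R) ∧ IsRegular (R ⧸ J) rs ∧
    (rs.length : WithBot (WithTop ℕ)) = ringKrullDim (R ⧸ J)

/-- A Cohen-Macaulay local ring. -/
def IsCMLocalRing [IsLocalRing R] : Prop := IsCMQuot R ⊥

/-- A Gorenstein local ring: Cohen-Macaulay of type 1. -/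
def IsGorensteinLocalRing [IsLocalRing R] : Prop :=
  IsCMLocalRing R ∧ ∃ d : ℕ, (d : WithBot (WithTop ℕ)) = ringKrullDim R ∧
    HasBass R (ModuleCat.of R R) d 1

/-- `M` has rank `r`: `M ⊗ Q` is free of rank `r` over the total quotient ring `Q`. -/
def HasRank (M : Type) [AddCommGroup M] [Module R M] (r : ℕ) : Prop :=
  Nonempty (LocalizedModule (nonZeroDivisors R) M ≃ₗ[Localization (nonZeroDivisors R)]
    (Fin r → Localization (nonZeroDivisors R)))

end


open TensorProduct

/-- A finitely generated module over a local ring has a minimal free cover. -/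
lemma exists_minimal_free_cover {R M : Type} [CommRing R] [IsLocalRing R] [AddCommGroup M]
    [Module R M] [Module.Finite R M] :
    ∃ (b : ℕ) (f : (Fin b → R) →ₗ[R] M), Function.Surjective f ∧
      ∀ x, f x = 0 → ∀ i, x i ∈ maximalIdeal R := by
  let B := Module.finBasis (ResidueField R) (ResidueField R ⊗[R] M)
  have hs := TensorProduct.mk_surjective R M (ResidueField R) Ideal.Quotient.mk_surjective
  choose v hv using fun i => hs (B i)
  refine ⟨_, Fintype.linearCombination R v, ?_, ?_⟩
  · rw [← LinearMap.range_eq_top, Fintype.range_linearCombination]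
    exact span_eq_top_of_tmul_eq_basis v B hv
  · intro x hx i
    have h : ∑ i, residue R (x i) • B i = 0 := by
      have := congrArg (TensorProduct.mk R (ResidueField R) M 1) hx
      rw [Fintype.linearCombination_apply, map_sum, map_zero] at this
      rw [← this]
      refine Finset.sum_congr rfl fun i _ => ?_
      rw [map_smul, hv]
      exact algebraMap_smul (ResidueField R) (x i) (B i)
    rw [← residue_eq_zero_iff]
    exact Fintype.linearIndependent_iff.mp B.linearIndependent _ h i

/-- A finitely generated module over a Noetherian local ring has a minimal free resolution. -/
lemma exists_minimal_free_resolution {R M : Type} [CommRing R] [IsNoetherianRing R]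
    [IsLocalRing R] [AddCommGroup M] [Module R M] [Module.Finite R M] :
    ∃ (b : ℕ → ℕ) (d : ∀ n, (Fin (b (n + 1)) → R) →ₗ[R] (Fin (b n) → R))
      (ε : (Fin (b 0) → R) →ₗ[R] M), Function.Surjective ε ∧ Function.Exact (d 0) ε ∧
      (∀ n, Function.Exact (d (n + 1)) (d n)) ∧ ∀ n x i, d n x i ∈ maximalIdeal R := by
  obtain ⟨b₀, ε, hε, hε'⟩ := exists_minimal_free_cover (R := R) (M := M)
  choose nb f hf hf' using fun s : (Σ b : ℕ, Submodule R (Fin b → R)) =>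
    exists_minimal_free_cover (R := R) (M := s.2)
  let s : ℕ → (Σ b : ℕ, Submodule R (Fin b → R)) := fun n =>
    Nat.rec ⟨b₀, LinearMap.ker ε⟩ (fun _ s => ⟨nb s, LinearMap.ker (f s)⟩) n
  have hs : ∀ n, ∀ x ∈ (s n).2, ∀ i, x i ∈ maximalIdeal R := by
    rintro (_ | n) x hx
    · exact hε' x hx
    · exact hf' (s n) x hx
  have hr : ∀ n, LinearMap.range ((s n).2.subtype ∘ₗ f (s n)) = (s n).2 := fun n => by
    rw [LinearMap.range_comp, LinearMap.range_eq_top.mpr (hf _), Submodule.map_top,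
      Submodule.range_subtype]
  refine ⟨fun n => (s n).1, fun n => (s n).2.subtype ∘ₗ f (s n), ε, hε, ?_, ?_, ?_⟩
  · exact LinearMap.exact_iff.mpr (hr 0).symm
  · intro n
    refine LinearMap.exact_iff.mpr (Eq.trans ?_ (hr (n + 1)).symm)
    rw [LinearMap.ker_comp, Submodule.ker_subtype]
    rfl
  · intro n x i
    exact hs n _ (f (s n) x).2 i

/-- The Betti numbers are the ranks in a minimal free resolution. -/
lemma HasBetti.eq_of_minimal_free_resolution {R M : Type} [CommRing R]
    [IsLocalRing R] [AddCommGroup M] [Module R M] (b : ℕ → ℕ)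
    (d : ∀ n, (Fin (b (n + 1)) → R) →ₗ[R] (Fin (b n) → R))
    (ε : (Fin (b 0) → R) →ₗ[R] M) (hε : Function.Surjective ε) (h0 : Function.Exact (d 0) ε)
    (hd : ∀ n, Function.Exact (d (n + 1)) (d n)) (hm : ∀ n x i, d n x i ∈ maximalIdeal R)
    {j β : ℕ} (hβ : HasBetti R (ModuleCat.of R M) j β) : β = b j := by
  have sq : ∀ n, ModuleCat.ofHom (d (n + 1)) ≫ ModuleCat.ofHom (d n) = 0 := fun n => by
    rw [← ModuleCat.ofHom_comp, (hd n).linearMap_comp_eq_zero]; rfl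
  have sq0 : ModuleCat.ofHom (d 0) ≫ ModuleCat.ofHom ε = 0 := by
    rw [← ModuleCat.ofHom_comp, h0.linearMap_comp_eq_zero]; rfl
  let C : ChainComplex (ModuleCat R) ℕ :=
    ChainComplex.of (fun n => ModuleCat.of R (Fin (b n) → R)) (fun n => ModuleCat.ofHom (d n)) sq
  have hC : ∀ n, C.d (n + 1) n = ModuleCat.ofHom (d n) := fun n =>
    ChainComplex.of_d (fun n => ModuleCat.of R (Fin (b n) → R)) (fun n => ModuleCat.ofHom (d n)) n
  let P : ProjectiveResolution (ModuleCat.of R M) :=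
    { complex := C
      projective := fun n => by
        change Projective (ModuleCat.of R (Fin (b n) → R))
        exact ModuleCat.projective_of_free (Pi.basisFun R (Fin (b n)))
      π := (ChainComplex.toSingle₀Equiv _ _).symm ⟨ModuleCat.ofHom ε, by rw [hC]; exact sq0⟩
      quasiIso := ⟨fun n => by
        obtain _ | n := n
        · rw [ChainComplex.quasiIsoAt₀_iff, ShortComplex.quasiIso_iff_of_zeros']
          · let S := ShortComplex.mk (ModuleCat.ofHom (d 0)) (ModuleCat.ofHom ε) sq0
            refine (ShortComplex.exact_and_epi_g_iff_of_iso (S₂ := S) ?_).2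
              ⟨(ShortComplex.ShortExact.moduleCat_exact_iff_function_exact S).2 h0,
                (ModuleCat.epi_iff_surjective _).2 hε⟩
            exact ShortComplex.isoMk (Iso.refl _) (Iso.refl _) (Iso.refl _)
              (by simp [S, hC]; rfl) (by simp [S]; rfl)
          all_goals rfl
        · rw [quasiIsoAt_iff_exactAt']
          · rw [HomologicalComplex.exactAt_iff' _ (n + 1 + 1) (n + 1) n (by simp) (by simp)]
            refine (ShortComplex.ShortExact.moduleCat_exact_iff_function_exact _).2 ?_
            change Function.Exact (C.d (n + 1 + 1) (n + 1)) (C.d (n + 1) n)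
            rw [hC, hC]
            exact hd n
          · apply ChainComplex.exactAt_succ_single_obj⟩ }
  let F := (MonoidalCategory.tensoringLeft (ModuleCat R)).obj (ModuleCat.of R (ResidueField R))
  let K := (F.mapHomologicalComplex (ComplexShape.down ℕ)).obj C
  have hF : ∀ n, F.map (ModuleCat.ofHom (d n)) = 0 := fun n => by
    refine ModuleCat.hom_ext (TensorProduct.ext' fun a x => ?_)
    change a ⊗ₜ[R] d n x = 0
    rw [pi_eq_sum_univ (d n x), TensorProduct.tmul_sum]
    refine Finset.sum_eq_zero fun i _ => ?_
    rw [← TensorProduct.smul_tmul, ← algebraMap_smul (ResidueField R),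
      show algebraMap R (ResidueField R) (d n x i) = 0 from
        (residue_eq_zero_iff _).mpr (hm n x i), zero_smul, TensorProduct.zero_tmul]
  have hK : ∀ i j, K.d i j = 0 := fun i j => by
    by_cases h : j + 1 = i
    · subst h
      exact (congrArg F.map (hC j)).trans (hF j)
    · exact K.shape i j h
  let e : TorM R j (ModuleCat.of R (ResidueField R)) (ModuleCat.of R M) ≅ K.X j :=
    P.isoLeftDerivedObj F j ≪≫
      (ShortComplex.HomologyData.ofZeros (K.sc j) (hK _ _) (hK _ _)).left.homologyIso
  obtain ⟨e'⟩ := hβ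
  let l : (Fin (b j) → ResidueField R) ≃ₗ[R] (Fin β → ResidueField R) :=
    (TensorProduct.piScalarRight R R (ResidueField R) (Fin (b j))).symm ≪≫ₗ
      (e.symm ≪≫ e').toLinearEquiv
  have := (l.extendScalarsOfSurjective (residue_surjective (R := R))).finrank_eq
  simpa using this.symm

/-- Ranks in a free resolution of a submodule of `R`: truncated alternating sums at odd places. -/
lemma neg_one_le_alternating_sum_of_free_resolution {R : Type} [CommRing R] [IsNoetherianRing R]
    [Nontrivial R] (I : Ideal R) (b : ℕ → ℕ)
    (d : ∀ n, (Fin (b (n + 1)) → R) →ₗ[R] (Fin (b n) → R))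
    (ε : (Fin (b 0) → R) →ₗ[R] I) (hε : Function.Surjective ε) (h0 : Function.Exact (d 0) ε)
    (hd : ∀ n, Function.Exact (d (n + 1)) (d n)) (n : ℕ) :
    (-1 : ℤ) ≤ ∑ j ∈ Finset.range (2 * n + 2), (-1) ^ (j + 1) * (b j : ℤ) := by
  obtain ⟨p, hp⟩ := Ideal.nonempty_minimalPrimes (R := R) (I := ⊥) top_ne_bot.symm
  have : p.IsPrime := hp.1.1
  let A := Localization.AtPrime p
  have : Ring.KrullDimLE 0 A := .of_isLocalization _ hp _
  have : IsArtinianRing A := IsNoetherianRing.isArtinianRing_of_krullDimLE_zero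
  let ℓ (M : Type) [AddCommGroup M] [Module R M] : ℕ∞ := Module.length A (A ⊗[R] M)
  let L := Module.length A A
  have hL : L ≠ ⊤ := Module.length_ne_top
  have hL0 : L ≠ 0 := Module.length_pos.ne'
  have key : ∀ (k : ℕ) (M : Type) [AddCommGroup M] [Module R M] (f : (Fin k → R) →ₗ[R] M),
      Function.Surjective f → k * L = ℓ (LinearMap.ker f) + ℓ M := by
    intro k M _ _ f hf
    have h1 : Module.length A (A ⊗[R] (Fin k → R)) = k * L := by
      rw [Module.length_of_free_of_finite]
      simp [L]
    rw [← h1]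
    refine Module.length_eq_add_of_exact ((LinearMap.ker f).subtype.baseChange A)
      (f.baseChange A) ?_ ?_ ?_
    · exact Module.Flat.lTensor_preserves_injective_linearMap _ (Submodule.injective_subtype _)
    · exact LinearMap.lTensor_surjective _ hf
    · exact lTensor_exact _ (LinearMap.exact_subtype_ker_map f) hf
  have e1 := key _ _ ε hε
  have e2 : ∀ n, b (n + 1) * L = ℓ (LinearMap.range (d (n + 1))) + ℓ (LinearMap.range (d n)) := fun n => by
    have := key _ _ (d n).rangeRestrict (d n).surjective_rangeRestrict
    rwa [LinearMap.ker_rangeRestrict, LinearMap.exact_iff.mp (hd n)] at this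
  rw [LinearMap.exact_iff.mp h0] at e1
  have hI : ℓ I ≤ L := by
    have : Module.length A (A ⊗[R] R) = L := (AlgebraTensorModule.rid R A A).length_eq
    rw [← this]
    exact Module.length_le_of_injective (I.subtype.baseChange A)
      (Module.Flat.lTensor_preserves_injective_linearMap _ (Submodule.injective_subtype _))
  have hfin : ∀ n, ℓ (LinearMap.range (d n)) ≠ ⊤ := fun n h => by
    have := e2 n
    rw [h, add_top] at this
    exact WithTop.mul_ne_top (ENat.natCast_ne_top _) hL this
  have hfinI : ℓ I ≠ ⊤ := ne_top_of_le_ne_top hL hI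
  obtain ⟨T, hT⟩ : ∃ T : ℕ → ℕ, ∀ n, ℓ (LinearMap.range (d n)) = T n :=
    ⟨fun n => (ℓ (LinearMap.range (d n))).toNat, fun n => (ENat.natCast_toNat (hfin n)).symm⟩
  obtain ⟨i, hi⟩ : ∃ i : ℕ, ℓ I = i := ⟨_, (ENat.natCast_toNat hfinI).symm⟩
  obtain ⟨l, hl⟩ : ∃ l : ℕ, L = l := ⟨_, (ENat.natCast_toNat hL).symm⟩
  simp only [hT, hi, hl] at e1 e2 hI hL0
  norm_cast at e1 e2 hI hL0
  have hsum : ∀ n : ℕ, (∑ j ∈ Finset.range (2 * n + 2), (-1) ^ (j + 1) * (b j : ℤ)) * l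
      = T (2 * n + 1) - i := by
    intro n
    induction n with
    | zero =>
      simp [Finset.sum_range_succ]
      have := e2 0
      zify at *
      linarith
    | succ n ih =>
      rw [show 2 * (n + 1) + 2 = (2 * n + 2) + 1 + 1 by ring, Finset.sum_range_succ,
        Finset.sum_range_succ, add_mul, add_mul, ih]
      have h1 : b (2 * n + 2) * l = T (2 * n + 2) + T (2 * n + 1) := e2 (2 * n + 1)
      have h2 : b (2 * n + 2 + 1) * l = T (2 * (n + 1) + 1) + T (2 * n + 2) := e2 (2 * n + 2)
      have hs : (-1 : ℤ) ^ (2 * n + 2) = 1 := Even.neg_one_pow ⟨n + 1, by ring⟩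
      rw [pow_succ _ (2 * n + 2 + 1), pow_succ _ (2 * n + 2), hs]
      zify at h1 h2
      linarith
  have := hsum n
  by_contra! hlt
  zify at *
  have hl' : (0 : ℤ) < l := by positivity
  nlinarith

theorem stmt0 (R : Type) [CommRing R] [IsNoetherianRing R] [IsLocalRing R]
    (I : Ideal R) (β : ℕ → ℕ)
    (hβ : ∀ j, HasBetti R (ModuleCat.of R I) j (β j)) :
    (∀ n : ℕ, (-1 : ℤ) ≤ ∑ j ∈ Finset.range (2*n+2), (-1)^(j+1) * (β j : ℤ)) ∧
    (-1 : ℤ) ≤ (β 1 : ℤ) - (β 0 : ℤ) := by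
  obtain ⟨b, d, ε, hε, h0, hd, hm⟩ := exists_minimal_free_resolution (R := R) (M := I)
  obtain rfl : β = b := funext fun j =>
    (hβ j).eq_of_minimal_free_resolution b d ε hε h0 hd hm
  have h := neg_one_le_alternating_sum_of_free_resolution I β d ε hε h0 hd
  refine ⟨h, ?_⟩
  have := h 0
  simp [Finset.sum_range_succ] at this
  linarith
end

section
/- Let (R, m, k) be a Noetherian local ring and I an ideal. If β_1^R(I) - β_0^R(I) = -1 and R is unmixed (all associated primes of R have the same height), then I has positive grade. -/
open CategoryTheory IsLocalRing RingTheory.Sequence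

open TensorProduct in
/-- Let `P₂ → P₁ → P₀ → X → 0` be a presentation by a complex with `P₀` projective, and let
`π : F → X` be a surjection from a projective module. Comparing the two, there is a map
`P₁ → ker π` vanishing on the image of `P₂` such that, after tensoring with `A`, the cycles in
degree one surject onto the kernel of `A ⊗ ker π → A ⊗ F`. -/
lemma LinearMap.exists_map_ker_lTensor {R P₂ P₁ P₀ X F : Type*} [CommRing R]
    [AddCommGroup P₂] [AddCommGroup P₁] [AddCommGroup P₀] [AddCommGroup X] [AddCommGroup F]
    [Module R P₂] [Module R P₁] [Module R P₀] [Module R X] [Module R F]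
    [Module.Projective R P₀] [Module.Projective R F]
    (A : Type*) [AddCommGroup A] [Module R A]
    {d₂ : P₂ →ₗ[R] P₁} {d₁ : P₁ →ₗ[R] P₀} {ε : P₀ →ₗ[R] X} {π : F →ₗ[R] X}
    (hd : d₁ ∘ₗ d₂ = 0) (hex : Function.Exact d₁ ε) (hε : Function.Surjective ε)
    (hπ : Function.Surjective π) :
    ∃ θ : P₁ →ₗ[R] LinearMap.ker π, θ ∘ₗ d₂ = 0 ∧
      ∀ z : A ⊗[R] LinearMap.ker π, (LinearMap.ker π).subtype.lTensor A z = 0 →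
        ∃ y : A ⊗[R] P₁, d₁.lTensor A y = 0 ∧ θ.lTensor A y = z := by
  obtain ⟨φ, hφ⟩ := Module.projective_lifting_property π ε hπ
  obtain ⟨ψ, hψ⟩ := Module.projective_lifting_property ε π hε
  have hφ' : ∀ x, π (φ x) = ε x := fun x ↦ LinearMap.congr_fun hφ x
  have hψ' : ∀ x, ε (ψ x) = π x := fun x ↦ LinearMap.congr_fun hψ x
  let θ : P₁ →ₗ[R] LinearMap.ker π := (φ ∘ₗ d₁).codRestrict _ fun x ↦ by
    simp [hφ', hex.apply_apply_eq_zero]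
  let h : F →ₗ[R] LinearMap.ker π := (φ ∘ₗ ψ - LinearMap.id).codRestrict _ fun x ↦ by
    simp [hφ', hψ']
  let ψK : LinearMap.ker π →ₗ[R] LinearMap.range d₁ :=
    (ψ ∘ₗ (LinearMap.ker π).subtype).codRestrict _ fun x ↦
      (hex _).1 (by simp [hψ'])
  let φK : LinearMap.range d₁ →ₗ[R] LinearMap.ker π :=
    (φ ∘ₗ (LinearMap.range d₁).subtype).codRestrict _ fun x ↦ by
      simpa [hφ'] using (hex x.1).2 x.2
  refine ⟨θ, ?_, fun z hz ↦ ?_⟩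
  · ext x
    simpa [θ] using congrArg φ (LinearMap.congr_fun hd x)
  obtain ⟨y, hy⟩ := LinearMap.lTensor_surjective A d₁.surjective_rangeRestrict (ψK.lTensor A z)
  refine ⟨y, ?_, ?_⟩
  · have h1 : d₁ = (LinearMap.range d₁).subtype ∘ₗ d₁.rangeRestrict := rfl
    have h2 : (LinearMap.range d₁).subtype ∘ₗ ψK = ψ ∘ₗ (LinearMap.ker π).subtype := rfl
    rw [h1, LinearMap.lTensor_comp_apply, hy, ← LinearMap.lTensor_comp_apply, h2,
      LinearMap.lTensor_comp_apply, hz, map_zero]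
  · have h1 : θ = φK ∘ₗ d₁.rangeRestrict := rfl
    have h2 : φK ∘ₗ ψK = LinearMap.id + h ∘ₗ (LinearMap.ker π).subtype := by
      ext x
      change φ (ψ x) = x + (φ (ψ x) - x)
      abel
    rw [h1, LinearMap.lTensor_comp_apply, hy, ← LinearMap.lTensor_comp_apply, h2,
      LinearMap.lTensor_add, LinearMap.add_apply, LinearMap.lTensor_comp_apply, hz]
    simp

/-- A map out of the middle term that kills boundaries bounds the length of the submodule hit by
cycles by the length of the homology. -/
lemma CategoryTheory.ShortComplex.length_le_length_homology {R : Type} [CommRing R]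
    (S : ShortComplex (ModuleCat.{0} R)) {N : Type*} [AddCommGroup N] [Module R N]
    (θ : S.X₂ →ₗ[R] N) (hθ : θ ∘ₗ S.f.hom = 0) (N' : Submodule R N)
    (h : ∀ z ∈ N', ∃ y, S.g.hom y = 0 ∧ θ y = z) :
    Module.length R N' ≤ Module.length R S.homology := by
  let θ' : (LinearMap.ker S.g.hom ⧸ LinearMap.range S.moduleCatToCycles) →ₗ[R] N :=
    (LinearMap.range S.moduleCatToCycles).liftQ (θ ∘ₗ (LinearMap.ker S.g.hom).subtype) (by
      rintro _ ⟨x, rfl⟩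
      exact LinearMap.congr_fun hθ x)
  have hle : N' ≤ LinearMap.range θ' := fun z hz ↦ by
    obtain ⟨y, hy, hyz⟩ := h z hz
    exact ⟨Submodule.Quotient.mk ⟨y, hy⟩, hyz⟩
  have e : S.homology ≃ₗ[R] (LinearMap.ker S.g.hom ⧸ LinearMap.range S.moduleCatToCycles) :=
    S.moduleCatHomologyIso.toLinearEquiv
  rw [e.length_eq]
  exact (Module.length_le_of_injective _ (Submodule.inclusion_injective hle)).trans
    (Module.length_le_of_surjective _ θ'.surjective_rangeRestrict)

/-- Dimension shifting: for a surjection `π : F → X` from a projective module, the kernel of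
`A ⊗ ker π → A ⊗ F` has length at most that of `Tor₁(A, X)`. -/
lemma length_ker_lTensor_le_length_tor_one {R : Type} [CommRing R] (A X : ModuleCat.{0} R)
    {F : Type} [AddCommGroup F] [Module R F] [Module.Projective R F] (π : F →ₗ[R] X)
    (hπ : Function.Surjective π) :
    Module.length R (LinearMap.ker ((LinearMap.ker π).subtype.lTensor A)) ≤
      Module.length R (TorM R 1 A X) := by
  let P := projectiveResolution X
  let T := (MonoidalCategory.tensoringLeft (ModuleCat.{0} R)).obj A
  let K := (T.mapHomologicalComplex (ComplexShape.down ℕ)).obj P.complex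
  have e : TorM R 1 A X ≃ₗ[R] (K.sc' 2 1 0).homology :=
    (P.isoLeftDerivedObj T 1 ≪≫ K.homologyIsoSc' 2 1 0 (by simp) (by simp)).toLinearEquiv
  have : Module.Projective R (P.complex.X 0) :=
    (IsProjective.iff_projective (P.complex.X 0)).2 (P.projective 0)
  let ε : P.complex.X 0 →ₗ[R] X := (P.π.f 0).hom
  have hex : Function.Exact (P.complex.d 1 0).hom ε :=
    (ShortComplex.ShortExact.moduleCat_exact_iff_function_exact _).1 P.exact₀
  have hε : Function.Surjective ε :=
    (ModuleCat.epi_iff_surjective (P.π.f 0)).1 inferInstance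
  obtain ⟨θ, hθ, h⟩ := LinearMap.exists_map_ker_lTensor A
    (d₂ := (P.complex.d 2 1).hom) (by rw [← ModuleCat.hom_comp]; simp) hex hε hπ
  rw [e.length_eq]
  refine (K.sc' 2 1 0).length_le_length_homology (θ.lTensor A) ?_ _ fun z hz ↦ h z hz
  change θ.lTensor A ∘ₗ (P.complex.d 2 1).hom.lTensor A = 0
  rw [← LinearMap.lTensor_comp, hθ, LinearMap.lTensor_zero]

/-- The residue field has length one. -/
lemma IsLocalRing.length_residueField (R : Type*) [CommRing R] [IsLocalRing R] :
    Module.length R (ResidueField R) = 1 := by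
  rw [Module.length_eq_of_surjective (R := ResidueField R) residue_surjective,
    Module.length_eq_one]

/-- Rank-nullity for length. -/
lemma LinearMap.length_eq_length_ker_add_length_range {R M N : Type*} [Ring R] [AddCommGroup M]
    [AddCommGroup N] [Module R M] [Module R N] (f : M →ₗ[R] N) :
    Module.length R M =
      Module.length R (LinearMap.ker f) + Module.length R (LinearMap.range f) :=
  Module.length_eq_add_of_exact (LinearMap.ker f).subtype f.rangeRestrict
    (Submodule.subtype_injective _) f.surjective_rangeRestrict
    (by rw [LinearMap.exact_iff, Submodule.range_subtype, LinearMap.ker_rangeRestrict])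

/-- The length of the range of a linear map is at most that of its source. -/
lemma LinearMap.length_range_le {R M N : Type*} [Ring R] [AddCommGroup M] [AddCommGroup N]
    [Module R M] [Module R N] (f : M →ₗ[R] N) :
    Module.length R (LinearMap.range f) ≤ Module.length R M :=
  Module.length_le_of_surjective f.rangeRestrict f.surjective_rangeRestrict

/-- Additivity of length for a right exact sequence. -/
lemma Module.length_eq_length_range_add_of_exact {R M N P : Type*} [Ring R] [AddCommGroup M]
    [AddCommGroup N] [AddCommGroup P] [Module R M] [Module R N] [Module R P] {f : M →ₗ[R] N}
    {g : N →ₗ[R] P} (h : Function.Exact f g) (hg : Function.Surjective g) :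
    Module.length R N = Module.length R (LinearMap.range f) + Module.length R P :=
  Module.length_eq_add_of_exact (LinearMap.range f).subtype g (Submodule.subtype_injective _) hg
    (by rw [LinearMap.exact_iff, Submodule.range_subtype, LinearMap.exact_iff.1 h])

/-- A Betti number is the length of the corresponding `Tor` module. -/
lemma HasBetti.length_eq {R : Type} [CommRing R] [IsLocalRing R] {M : ModuleCat R} {j b : ℕ}
    (h : HasBetti R M j b) :
    Module.length R (TorM R j (ModuleCat.of R (ResidueField R)) M) = b := by
  obtain ⟨e⟩ := h
  have e' : TorM R j (ModuleCat.of R (ResidueField R)) M ≃ₗ[R] (Fin b → ResidueField R) :=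
    e.toLinearEquiv
  rw [e'.length_eq, Module.length_pi, length_residueField]
  simp

open TensorProduct in
/-- The zeroth Betti number of `M` is the length of `k ⊗ M`. -/
lemma HasBetti.length_tensorProduct_eq {R : Type} [CommRing R] [IsLocalRing R] {M : ModuleCat R}
    {b : ℕ} (h : HasBetti R M 0 b) :
    Module.length R (ResidueField R ⊗[R] M) = b := by
  let T := (MonoidalCategory.tensoringLeft (ModuleCat.{0} R)).obj
    (ModuleCat.of R (ResidueField R))
  have : Limits.PreservesFiniteColimits T :=
    inferInstanceAs (Limits.PreservesFiniteColimits (MonoidalCategory.tensorLeft _))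
  have e : TorM R 0 (ModuleCat.of R (ResidueField R)) M ≃ₗ[R] (ResidueField R ⊗[R] M) :=
    (T.leftDerivedZeroIsoSelf.app M).toLinearEquiv
  rw [← e.length_eq, h.length_eq]

open TensorProduct in
/-- A finite module over a local ring is generated by `n` elements as soon as its fibre over the
residue field has length at most `n`. -/
lemma IsLocalRing.exists_surjective_of_length_le {R M : Type*} [CommRing R] [IsLocalRing R]
    [AddCommGroup M] [Module R M] [Module.Finite R M] {n : ℕ}
    (h : Module.length R (ResidueField R ⊗[R] M) ≤ n) :
    ∃ f : (Fin n → R) →ₗ[R] M, Function.Surjective f := by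
  have hfin : Module.finrank (ResidueField R) (ResidueField R ⊗[R] M) ≤ n := by
    rw [Module.length_eq_of_surjective (R := ResidueField R) residue_surjective,
      Module.length_eq_finrank] at h
    exact_mod_cast h
  let b := Module.finBasis (ResidueField R) (ResidueField R ⊗[R] M)
  have hmk : Function.Surjective (TensorProduct.mk R (ResidueField R) M 1) :=
    TensorProduct.mk_surjective R M (ResidueField R) residue_surjective
  choose v hv using fun i ↦ hmk (b i)
  have hspan := span_eq_top_of_tmul_eq_basis v b hv
  let w : Fin n → M := fun i ↦ if hi : i.1 < _ then v ⟨i, hi⟩ else 0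
  refine ⟨Fintype.linearCombination R w, ?_⟩
  rw [← LinearMap.range_eq_top, Fintype.range_linearCombination, eq_top_iff, ← hspan]
  refine Submodule.span_mono ?_
  rintro _ ⟨i, rfl⟩
  exact ⟨⟨i, i.2.trans_le hfin⟩, by simp [w]⟩

open TensorProduct in
/-- If `β₁(M) + 1 = β₀(M)`, then `M` has a presentation with one more generator than relations. -/
lemma exists_presentation_of_hasBetti {R : Type} [CommRing R] [IsNoetherianRing R] [IsLocalRing R]
    {M : ModuleCat R} [Module.Finite R M] {b₁ : ℕ} (h₀ : HasBetti R M 0 (b₁ + 1))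
    (h₁ : HasBetti R M 1 b₁) :
    ∃ (n : ℕ) (f : (Fin n → R) →ₗ[R] (Fin (n + 1) → R)) (g : (Fin (n + 1) → R) →ₗ[R] M),
      Function.Exact f g ∧ Function.Surjective g := by
  let k := ResidueField R
  obtain ⟨g, hg⟩ := IsLocalRing.exists_surjective_of_length_le
    (h₀.length_tensorProduct_eq).le
  let ι := (LinearMap.ker g).subtype
  have hTor := (length_ker_lTensor_le_length_tor_one (ModuleCat.of R k) M g hg).trans_eq
    h₁.length_eq
  have hF : Module.length R (k ⊗[R] (Fin (b₁ + 1) → R)) = (b₁ + 1 : ℕ) := by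
    rw [(TensorProduct.piScalarRight R R k (Fin (b₁ + 1))).length_eq, Module.length_pi,
      length_residueField]
    simp
  have hι : Function.Exact (ι.lTensor k) (g.lTensor k) :=
    lTensor_exact k (LinearMap.exact_subtype_ker_map g) hg
  have hsplit : Module.length R (k ⊗[R] (Fin (b₁ + 1) → R)) =
      Module.length R (LinearMap.range (ι.lTensor k)) + Module.length R (k ⊗[R] M) :=
    Module.length_eq_length_range_add_of_exact hι (LinearMap.lTensor_surjective k hg)
  have hrange : Module.length R (LinearMap.range (ι.lTensor k)) = 0 := by
    rw [hF, h₀.length_tensorProduct_eq] at hsplit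
    generalize Module.length R (LinearMap.range (ι.lTensor k)) = r at hsplit ⊢
    refine ENat.add_left_injective_of_ne_top (ENat.natCast_ne_top (b₁ + 1)) ?_
    simpa using hsplit.symm
  have hK : Module.length R (k ⊗[R] LinearMap.ker g) ≤ b₁ := by
    rw [LinearMap.length_eq_length_ker_add_length_range (ι.lTensor k), hrange, add_zero]
    exact hTor
  obtain ⟨f, hf⟩ := IsLocalRing.exists_surjective_of_length_le hK
  refine ⟨b₁, ι ∘ₗ f, g, ?_, hg⟩
  rw [LinearMap.exact_iff, LinearMap.range_comp_of_range_eq_top _ (LinearMap.range_eq_top.2 hf),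
    Submodule.range_subtype]

open TensorProduct in
/-- An ideal with a presentation with one more generator than relations is not contained in a
prime at which the localization is Artinian. -/
lemma Ideal.not_le_of_presentation {R : Type*} [CommRing R] {I : Ideal R} {n : ℕ}
    {f : (Fin n → R) →ₗ[R] (Fin (n + 1) → R)} {g : (Fin (n + 1) → R) →ₗ[R] I}
    (hfg : Function.Exact f g) (hg : Function.Surjective g) (p : Ideal R) [p.IsPrime]
    [IsArtinianRing (Localization.AtPrime p)] : ¬ I ≤ p := by
  intro hIp
  let A := Localization.AtPrime p
  have hA : Module.length A A ≠ ⊤ := Module.length_ne_top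
  have hfree (m : ℕ) : Module.length A (A ⊗[R] (Fin m → R)) = m * Module.length A A := by
    rw [(TensorProduct.piScalarRight R A A (Fin m)).length_eq, Module.length_pi]
    simp
  have hexA : Function.Exact (f.baseChange A) (g.baseChange A) := lTensor_exact A hfg hg
  have hgA : Function.Surjective (g.baseChange A) := LinearMap.lTensor_surjective A hg
  have h1 := Module.length_eq_length_range_add_of_exact hexA hgA
  have h2 := LinearMap.length_range_le (f.baseChange A)
  rw [hfree] at h1 h2
  let j : A ⊗[R] I →ₗ[A] A :=
    (TensorProduct.AlgebraTensorModule.rid R A A).toLinearMap ∘ₗ I.subtype.baseChange A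
  have hj : Function.Injective j :=
    (TensorProduct.AlgebraTensorModule.rid R A A).injective.comp
      (Module.Flat.lTensor_preserves_injective_linearMap I.subtype I.subtype_injective)
  have hjp : LinearMap.range j ≤ maximalIdeal A := by
    rintro _ ⟨x, rfl⟩
    induction x with
    | zero => simp
    | add x y hx hy => simpa using add_mem hx hy
    | tmul a x =>
      have : algebraMap R A x ∈ maximalIdeal A :=
        (IsLocalization.AtPrime.to_map_mem_maximal_iff A p x.1).2 (hIp x.2)
      simpa [j, Algebra.smul_def] using Ideal.mul_mem_right a _ this
  have hlt : Module.length A (LinearMap.range j) < Module.length A A :=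
    Submodule.length_lt fun h ↦ (maximalIdeal.isMaximal A).ne_top (top_le_iff.1 (h ▸ hjp))
  rw [← (LinearEquiv.ofInjective j hj).length_eq] at hlt
  generalize Module.length A A = l at *
  generalize Module.length A (A ⊗[R] I) = l' at *
  lift l to ℕ using hA
  have hl' := hlt.ne_top
  lift l' to ℕ using hl'
  have h3 : ((n + 1 : ℕ) : ℕ∞) * l ≤ n * l + l' := h1.trans_le (add_le_add_left h2 _)
  norm_cast at h3 hlt
  nlinarith

/-- If all associated primes of a Noetherian local ring have the same height, then they are all
minimal. -/
lemma height_eq_zero_of_mem_associatedPrimes {R : Type*} [CommRing R] [IsNoetherianRing R]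
    (hunm : ∀ p q : PrimeSpectrum R, p.asIdeal ∈ associatedPrimes R R →
      q.asIdeal ∈ associatedPrimes R R →
      ringKrullDim (Localization.AtPrime p.asIdeal) =
        ringKrullDim (Localization.AtPrime q.asIdeal))
    (p : PrimeSpectrum R) (hp : p.asIdeal ∈ associatedPrimes R R) :
    ringKrullDim (Localization.AtPrime p.asIdeal) = 0 := by
  obtain ⟨q, hq, hqp⟩ := Ideal.exists_minimalPrimes_le (I := ⊥) (J := p.asIdeal) bot_le
  have hqa : q ∈ associatedPrimes R R := by
    refine Module.associatedPrimes.minimalPrimes_annihilator_subset_associatedPrimes R R ?_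
    rwa [Module.annihilator_eq_bot.2 inferInstance]
  have := hq.1.1
  rw [hunm p ⟨q, this⟩ hp hqa, IsLocalization.AtPrime.ringKrullDim_eq_height q]
  exact_mod_cast Ideal.height_eq_zero_iff.2 hq

theorem stmt1 (R : Type) [CommRing R] [IsNoetherianRing R] [IsLocalRing R]
    (hunm : ∀ p q : PrimeSpectrum R, p.asIdeal ∈ associatedPrimes R R →
      q.asIdeal ∈ associatedPrimes R R →
      ringKrullDim (Localization.AtPrime p.asIdeal) =
        ringKrullDim (Localization.AtPrime q.asIdeal))
    (I : Ideal R) (b0 b1 : ℕ)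
    (hb0 : HasBetti R (ModuleCat.of R I) 0 b0)
    (hb1 : HasBetti R (ModuleCat.of R I) 1 b1)
    (hdiff : (b1 : ℤ) - (b0 : ℤ) = -1) :
    ∃ x ∈ I, x ∈ nonZeroDivisors R := by
  obtain rfl : b0 = b1 + 1 := by lia
  obtain ⟨n, f, g, hfg, hg⟩ := exists_presentation_of_hasBetti hb0 hb1
  by_contra! hI
  obtain ⟨p, hp, hIp⟩ : ∃ p ∈ associatedPrimes R R, I ≤ p :=
    (I.subset_union_prime_finite (associatedPrimes.finite ..) (f := id) 0 0
      fun _ h _ _ ↦ h.1).1 <| by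
        simp only [id, biUnion_associatedPrimes_eq_compl_nonZeroDivisors]
        exact fun x hx ↦ hI x hx
  have : p.IsPrime := hp.1
  have hdim := height_eq_zero_of_mem_associatedPrimes hunm ⟨p, hp.1⟩ hp
  have : Ring.KrullDimLE 0 (Localization.AtPrime p) := by
    rw [Ring.krullDimLE_iff]
    exact_mod_cast hdim.le
  have : IsArtinianRing (Localization.AtPrime p) :=
    isArtinianRing_iff_krullDimLE_zero.2 inferInstance
  exact Ideal.not_le_of_presentation hfg hg p hIp
end

section
/- Let (R, m, k) be a Noetherian local ring and I an ideal with grade(I) > 0. Then for every integer n ≥ 0, the alternating sum ∑_{j=0}^{2n} (-1)^{j+1} β_j^R(I) ≤ -1. -/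
open CategoryTheory IsLocalRing RingTheory.Sequence

namespace CategoryTheory

open Limits

universe u v u' v'

variable {C : Type u} [Category.{v} C] [Abelian C] {D : Type u'} [Category.{v'} D] [Abelian D]

/-- The augmentation of a projective resolution, as a morphism to the resolved object. -/
noncomputable def ProjectiveResolution.augmentation {Z : C} (P : ProjectiveResolution Z) :
    P.complex.X 0 ⟶ Z :=
  P.π.f 0

lemma ProjectiveResolution.d_comp_augmentation {Z : C} (P : ProjectiveResolution Z) :
    P.complex.d 1 0 ≫ P.augmentation = 0 :=
  P.complex_d_comp_π_f_zero

instance {Z : C} (P : ProjectiveResolution Z) : Epi P.augmentation :=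
  inferInstanceAs (Epi (P.π.f 0))

lemma ProjectiveResolution.exact_augmentation {Z : C} (P : ProjectiveResolution Z) :
    (ShortComplex.mk _ _ P.d_comp_augmentation).Exact :=
  ShortComplex.exact_of_g_is_cokernel _ P.isColimitCokernelCofork

lemma ProjectiveResolution.d_comp_augmentation_comp {Z Y : C} (P : ProjectiveResolution Z)
    (f : Z ⟶ Y) : P.complex.d 1 0 ≫ P.augmentation ≫ f = 0 := by
  rw [← Category.assoc, P.d_comp_augmentation, zero_comp]

/-- A projective resolution of the left term of a short exact sequence with projective middle term
gives a projective resolution of the right term. -/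
noncomputable def ProjectiveResolution.ofShortExact {S : ShortComplex C} (hS : S.ShortExact)
    [Projective S.X₂] (P : ProjectiveResolution S.X₁) : ProjectiveResolution S.X₃ where
  complex := P.complex.augment (P.augmentation ≫ S.f) (P.d_comp_augmentation_comp S.f)
  projective n := by
    cases n with
    | zero => exact inferInstanceAs (Projective S.X₂)
    | succ n => exact inferInstanceAs (Projective (P.complex.X n))
  π := (ChainComplex.toSingle₀Equiv _ _).symm ⟨S.g, by
    change (P.augmentation ≫ S.f) ≫ S.g = 0
    simp⟩
  quasiIso := ⟨fun n => by
    have := hS.mono_f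
    match n with
    | 0 =>
      rw [ChainComplex.quasiIsoAt₀_iff, ShortComplex.quasiIso_iff_of_zeros']
      · have hπ := ChainComplex.toSingle₀Equiv_symm_apply_f_zero
          (C := P.complex.augment (P.augmentation ≫ S.f) (P.d_comp_augmentation_comp S.f)) S.g
          (by change (P.augmentation ≫ S.f) ≫ S.g = 0; simp)
        refine ⟨?_, ?_⟩
        · let φ : ShortComplex.mk (P.augmentation ≫ S.f) S.g (by simp) ⟶ S :=
            { τ₁ := P.augmentation, τ₂ := 𝟙 _, τ₃ := 𝟙 _ }
          have : Epi φ.τ₁ := inferInstanceAs (Epi (P.augmentation))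
          have : IsIso φ.τ₂ := inferInstanceAs (IsIso (𝟙 _))
          have : Mono φ.τ₃ := inferInstanceAs (Mono (𝟙 _))
          have h := (ShortComplex.exact_iff_of_epi_of_isIso_of_mono φ).2 hS.exact
          refine (ShortComplex.exact_iff_of_iso ?_).2 h
          exact ShortComplex.isoMk (Iso.refl _) (Iso.refl _) (Iso.refl _)
            ((Category.id_comp _).trans (Category.comp_id _).symm)
            ((Category.id_comp _).trans (hπ.symm.trans (Category.comp_id _).symm))
        · have : Epi S.g := hS.epi_g
          rw [← hπ] at this
          exact this
      all_goals rfl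
    | 1 =>
      rw [quasiIsoAt_iff_exactAt' _ _ (ChainComplex.exactAt_succ_single_obj _ _),
        HomologicalComplex.exactAt_iff' _ 2 1 0 (by simp) (by simp)]
      let φ : ShortComplex.mk _ _ P.d_comp_augmentation ⟶
          ShortComplex.mk _ _ (P.d_comp_augmentation_comp S.f) :=
        { τ₁ := 𝟙 _, τ₂ := 𝟙 _, τ₃ := S.f }
      have : Epi φ.τ₁ := inferInstanceAs (Epi (𝟙 _))
      have : IsIso φ.τ₂ := inferInstanceAs (IsIso (𝟙 _))
      have : Mono φ.τ₃ := inferInstanceAs (Mono S.f)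
      exact (ShortComplex.exact_iff_of_epi_of_isIso_of_mono φ).1 P.exact_augmentation
    | n + 2 =>
      rw [quasiIsoAt_iff_exactAt' _ _ (ChainComplex.exactAt_succ_single_obj _ _),
        HomologicalComplex.exactAt_iff' _ (n + 3) (n + 2) (n + 1) (by simp) (by simp)]
      exact P.exact_succ n⟩

lemma ShortComplex.nonempty_homology_iso_cokernel (S : ShortComplex D) (hg : S.g = 0) :
    Nonempty (S.homology ≅ cokernel S.f) :=
  ⟨(HomologyData.ofHasCokernel S hg).left.homologyIso⟩

/-- Dimension shifting one degree further than usual, including degree zero, along a short exact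
sequence with projective middle term whose first map is killed by the functor. -/
lemma Functor.nonempty_leftDerived_succ_iso [HasProjectiveResolutions C]
    (F : C ⥤ D) [F.Additive] {S : ShortComplex C}
    (hS : S.ShortExact) [Projective S.X₂] (hF : F.map S.f = 0) (n : ℕ) :
    Nonempty ((F.leftDerived (n + 1)).obj S.X₃ ≅ (F.leftDerived n).obj S.X₁) := by
  let P := projectiveResolution S.X₁
  let Q := P.ofShortExact hS
  let K := (F.mapHomologicalComplex _).obj P.complex
  let L := (F.mapHomologicalComplex _).obj Q.complex
  suffices h : Nonempty (L.homology (n + 1) ≅ K.homology n) from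
    ⟨Q.isoLeftDerivedObj F (n + 1) ≪≫ h.some ≪≫ (P.isoLeftDerivedObj F n).symm⟩
  cases n with
  | zero =>
    have h₁ := (L.sc' 2 1 0).nonempty_homology_iso_cokernel (by
      change F.map (P.augmentation ≫ S.f) = 0
      rw [F.map_comp, hF, comp_zero])
    have h₂ := (K.sc' 1 0 0).nonempty_homology_iso_cokernel (K.shape _ _ (by simp))
    exact ⟨L.homologyIsoSc' 2 1 0 (by simp) (by simp) ≪≫ h₁.some ≪≫
      h₂.some.symm ≪≫ (K.homologyIsoSc' 1 0 0 (by simp) (by simp)).symm⟩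
  | succ n =>
    have e : L.sc' (n + 3) (n + 2) (n + 1) = K.sc' (n + 2) (n + 1) n := rfl
    exact ⟨L.homologyIsoSc' (n + 3) (n + 2) (n + 1) (by simp) (by simp) ≪≫
      eqToIso (congrArg (fun T : ShortComplex D => T.homology) e) ≪≫
      (K.homologyIsoSc' (n + 2) (n + 1) n (by simp) (by simp)).symm⟩

end CategoryTheory

open TensorProduct in
/-- A basis of `k ⊗ M` lifts to a minimal presentation of `M`. -/
lemma exists_surjective_and_lTensor_residueField_injective {R : Type*} [CommRing R] [IsLocalRing R]
    {M : Type*} [AddCommGroup M] [Module R M] [Module.Finite R M] {b : ℕ}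
    (e : ResidueField R ⊗[R] M ≃ₗ[R] (Fin b → ResidueField R)) :
    ∃ f : (Fin b → R) →ₗ[R] M, Function.Surjective f ∧
      Function.Injective (f.lTensor (ResidueField R)) := by
  let B : Module.Basis (Fin b) (ResidueField R) (ResidueField R ⊗[R] M) :=
    .ofEquivFun (e.extendScalarsOfSurjective (residue_surjective (R := R)))
  obtain ⟨v, hv⟩ := (TensorProduct.mk_surjective R M (ResidueField R)
    (residue_surjective (R := R))).comp_left B
  have hv' (i : Fin b) : (1 : ResidueField R) ⊗ₜ[R] v i = B i := congr_fun hv i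
  refine ⟨Fintype.linearCombination R v, ?_, ?_⟩
  · rw [← LinearMap.range_eq_top, Fintype.range_linearCombination]
    exact span_eq_top_of_tmul_eq_basis v B hv'
  · let P := (Pi.basisFun R (Fin b)).baseChange (ResidueField R)
    have h : (Fintype.linearCombination R v).baseChange (ResidueField R) =
        (P.equiv B (Equiv.refl _)).toLinearMap := by
      refine P.ext fun i => ?_
      simp only [LinearEquiv.coe_coe, Module.Basis.equiv_apply]
      simp [P, Module.Basis.baseChange_apply, Fintype.linearCombination_apply_single, hv']
    intro x y hxy
    apply (P.equiv B (Equiv.refl _)).injective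
    exact (DFunLike.congr_fun h x).symm.trans (Eq.trans hxy (DFunLike.congr_fun h y))

/-- The zeroth Betti number is the dimension of `k ⊗ M`. -/
lemma HasBetti.nonempty_tensor_equiv {R : Type} [CommRing R] [IsLocalRing R] {M : ModuleCat R}
    {b : ℕ} (h : HasBetti R M 0 b) :
    Nonempty (TensorProduct R (ResidueField R) M ≃ₗ[R] (Fin b → ResidueField R)) := by
  obtain ⟨e⟩ := h
  let F := (MonoidalCategory.tensoringLeft (ModuleCat R)).obj (ModuleCat.of R (ResidueField R))
  have : Limits.PreservesFiniteColimits F :=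
    inferInstanceAs (Limits.PreservesFiniteColimits
      (MonoidalCategory.tensorLeft (ModuleCat.of R (ResidueField R))))
  exact ⟨((F.leftDerivedZeroIsoSelf.app M).symm ≪≫ e).toLinearEquiv⟩

/-- The Betti numbers of a first syzygy in a minimal free resolution are the shifted ones. -/
lemma HasBetti.exists_syzygy {R : Type} [CommRing R] [IsNoetherianRing R] [IsLocalRing R]
    {M : Type} [AddCommGroup M] [Module R M] [Module.Finite R M] {β : ℕ → ℕ}
    (hβ : ∀ j, HasBetti R (ModuleCat.of R M) j (β j)) :
    ∃ f : (Fin (β 0) → R) →ₗ[R] M, Function.Surjective f ∧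
      ∀ j, HasBetti R (ModuleCat.of R (LinearMap.ker f)) j (β (j + 1)) := by
  obtain ⟨e⟩ := (hβ 0).nonempty_tensor_equiv
  obtain ⟨f, hf, hinj⟩ := exists_surjective_and_lTensor_residueField_injective e
  refine ⟨f, hf, fun j => ?_⟩
  let S : ShortComplex (ModuleCat R) :=
    ShortComplex.mk (ModuleCat.ofHom (LinearMap.ker f).subtype) (ModuleCat.ofHom f) (by
      ext x
      exact x.2)
  have hS : S.ShortExact :=
    { exact := (ShortComplex.ShortExact.moduleCat_exact_iff_function_exact S).2
        (LinearMap.exact_subtype_ker_map f)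
      mono_f := (ModuleCat.mono_iff_injective _).2 (LinearMap.ker f).injective_subtype
      epi_g := (ModuleCat.epi_iff_surjective _).2 hf }
  have : Projective S.X₂ :=
    inferInstanceAs (Projective (ModuleCat.of R (Fin (β 0) → R)))
  have hz : (LinearMap.ker f).subtype.lTensor (ResidueField R) = 0 := by
    refine LinearMap.ext fun x => hinj ?_
    rw [← LinearMap.comp_apply, ← LinearMap.lTensor_comp, LinearMap.comp_ker_subtype]
    simp
  obtain ⟨e'⟩ := Functor.nonempty_leftDerived_succ_iso
    ((MonoidalCategory.tensoringLeft (ModuleCat R)).obj (ModuleCat.of R (ResidueField R)))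
    hS (ModuleCat.hom_ext hz) j
  obtain ⟨e''⟩ := hβ (j + 1)
  exact ⟨e'.symm ≪≫ e''⟩

open TensorProduct in
/-- Partial alternating sums of Betti numbers bound the length of a base change to a flat
Artinian algebra, alternately from above and from below. -/
lemma alternating_betti_mul_length_le {R : Type} [CommRing R] [IsNoetherianRing R] [IsLocalRing R]
    (A : Type*) [CommRing A] [Nontrivial A] [Algebra R A] [Module.Flat R A] [IsArtinianRing A]
    (m : ℕ) (M : Type) [AddCommGroup M] [Module R M] [Module.Finite R M] (β : ℕ → ℕ)
    (hβ : ∀ j, HasBetti R (ModuleCat.of R M) j (β j)) :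
    0 ≤ (-1 : ℤ) ^ m * ((Module.length A (A ⊗[R] M)).toNat -
      (∑ j ∈ Finset.range m, (-1) ^ j * (β j : ℤ)) * (Module.length A A).toNat) := by
  induction m generalizing M β with
  | zero => simp
  | succ m ih =>
    obtain ⟨f, hf, hK⟩ := HasBetti.exists_syzygy hβ
    have hadd := Module.length_eq_add_of_exact
      ((LinearMap.ker f).subtype.baseChange A) (f.baseChange A)
      (Module.Flat.lTensor_preserves_injective_linearMap _ (LinearMap.ker f).injective_subtype)
      (LinearMap.lTensor_surjective A hf)
      (Module.Flat.lTensor_exact A (LinearMap.exact_subtype_ker_map f))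
    rw [Module.length_of_free_of_finite, Module.finrank_baseChange, Module.finrank_fin_fun] at hadd
    have hadd' := congrArg ENat.toNat hadd
    rw [ENat.toNat_add Module.length_ne_top Module.length_ne_top, ENat.toNat_mul,
      ENat.toNat_natCast] at hadd'
    have hM : ((Module.length A (A ⊗[R] M)).toNat : ℤ) =
        β 0 * (Module.length A A).toNat -
          (Module.length A (A ⊗[R] LinearMap.ker f)).toNat := by
      rw [eq_sub_iff_add_eq, add_comm]
      exact_mod_cast hadd'.symm
    convert ih _ _ hK using 1
    rw [Finset.sum_range_succ', hM]
    simp only [pow_succ, mul_neg, mul_one, neg_mul, Finset.sum_neg_distrib]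
    ring

theorem stmt2 (R : Type) [CommRing R] [IsNoetherianRing R] [IsLocalRing R]
    (I : Ideal R) (hgrade : ∃ x ∈ I, x ∈ nonZeroDivisors R)
    (β : ℕ → ℕ) (hβ : ∀ j, HasBetti R (ModuleCat.of R I) j (β j)) :
    ∀ n : ℕ, ∑ j ∈ Finset.range (2*n+1), (-1)^(j+1) * (β j : ℤ) ≤ -1 := by
  intro n
  obtain ⟨x, hxI, hx⟩ := hgrade
  obtain ⟨p, hp⟩ := Ideal.nonempty_minimalPrimes (I := (⊥ : Ideal R)) bot_ne_top
  have : p.IsPrime := hp.1.1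
  let A := Localization.AtPrime p
  have : IsNoetherianRing A := IsLocalization.isNoetherianRing p.primeCompl A inferInstance
  have : IsArtinianRing A := isArtinianRing_iff_krullDimLE_zero.2 (.of_isLocalization p hp A)
  have : Module.Flat R A := IsLocalization.flat A p.primeCompl
  have key := alternating_betti_mul_length_le A (2 * n + 1) I β hβ
  have hinj : Function.Injective (LinearMap.toSpanSingleton R I ⟨x, hxI⟩) := by
    intro r s hrs
    exact (mul_cancel_right_mem_nonZeroDivisors hx).1 (congrArg Subtype.val hrs)
  have hle : (Module.length A A).toNat ≤ (Module.length A (TensorProduct R A I)).toNat := by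
    refine ENat.toNat_le_toNat ?_ Module.length_ne_top
    rw [← (TensorProduct.AlgebraTensorModule.rid R A A).length_eq]
    exact Module.length_le_of_injective
      ((LinearMap.toSpanSingleton R I ⟨x, hxI⟩).baseChange A)
      (Module.Flat.lTensor_preserves_injective_linearMap _ hinj)
  have hpos : 0 < (Module.length A A).toNat :=
    ENat.toNat_pos Module.length_pos.ne' Module.length_ne_top
  rw [(odd_two_mul_add_one n).neg_one_pow] at key
  simp only [pow_succ, mul_neg, mul_one, neg_mul, Finset.sum_neg_distrib, neg_le_neg_iff]
  have hle' : ((Module.length A A).toNat : ℤ) ≤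
    (Module.length A (TensorProduct R A I)).toNat := by exact_mod_cast hle
  have hpos' : (0 : ℤ) < (Module.length A A).toNat := by exact_mod_cast hpos
  by_contra! h
  nlinarith
end

section
/- Let R be a Noetherian local ring, M a finitely generated R-module that has a rank r (i.e. M ⊗_R Q is free of rank r over the total ring of fractions Q of R). Then for all i ≥ 0: β_i^R(M) - β_{i+1}^R(M) ≤ ∑_{j=1}^{i} (-1)^{j-1} β_{i-j}^R(M) + (-1)^i r. Moreover, equality holds if and only if β_{i+2}^R(M) = 0. -/
open CategoryTheory IsLocalRing RingTheory.Sequence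

open scoped TensorProduct in
/-- A finite module over a local ring has a minimal free cover. -/
theorem exists_minimal_cover (R : Type) [CommRing R] [IsLocalRing R] (N : Type)
    [AddCommGroup N] [Module R N] [Module.Finite R N] :
    ∃ (b : ℕ) (f : (Fin b → R) →ₗ[R] N), Function.Surjective f ∧
      ∀ x, f x = 0 → ∀ i, x i ∈ maximalIdeal R := by
  let k := ResidueField R
  let e := Module.finBasis k (k ⊗[R] N)
  have hs : Function.Surjective (TensorProduct.mk R k N 1) :=
    TensorProduct.mk_surjective R N k Ideal.Quotient.mk_surjective
  choose n hn using fun i => hs (e i)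
  refine ⟨_, Fintype.linearCombination R n, ?_, fun x hx => ?_⟩
  · rw [← LinearMap.range_eq_top, Fintype.range_linearCombination]
    exact IsLocalRing.span_eq_top_of_tmul_eq_basis n e hn
  · have h : ∑ i, residue R (x i) • e i = 0 := by
      have := congrArg (TensorProduct.mk R k N 1) hx
      rw [Fintype.linearCombination_apply, map_sum, map_zero] at this
      rw [← this]
      refine Finset.sum_congr rfl fun i _ => ?_
      rw [map_smul, hn]
      exact algebraMap_smul k (x i) (e i)
    intro i
    rw [← residue_eq_zero_iff]
    exact Fintype.linearIndependent_iff.mp e.linearIndependent _ h i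

/-- A map of free modules with entries in the maximal ideal vanishes over the residue field. -/
theorem lTensor_residueField_eq_zero (R : Type) [CommRing R] [IsLocalRing R] {P : Type}
    [AddCommGroup P] [Module R P] {b : ℕ} (f : P →ₗ[R] (Fin b → R))
    (hf : ∀ x i, f x i ∈ maximalIdeal R) :
    f.lTensor (ResidueField R) = 0 := by
  refine TensorProduct.ext' fun c x => ?_
  rw [LinearMap.lTensor_tmul, LinearMap.zero_apply, pi_eq_sum_univ' (f x), TensorProduct.tmul_sum]
  refine Finset.sum_eq_zero fun i _ => ?_
  rw [← TensorProduct.smul_tmul, ← algebraMap_smul (ResidueField R) (f x i) c]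
  have : algebraMap R (ResidueField R) (f x i) = 0 := (residue_eq_zero_iff _).mpr (hf x i)
  rw [this, zero_smul, TensorProduct.zero_tmul]

/-- `N` becomes, over the total quotient ring, stably free of rank `s`. -/
def HasStableRank (R : Type) [CommRing R] (N : Type) [AddCommGroup N] [Module R N] (s : ℤ) :
    Prop :=
  ∃ m n : ℕ, (m : ℤ) - n = s ∧ Nonempty
    ((LocalizedModule (nonZeroDivisors R) N × (Fin n → Localization (nonZeroDivisors R)))
      ≃ₗ[Localization (nonZeroDivisors R)] (Fin m → Localization (nonZeroDivisors R)))

theorem HasRank.hasStableRank {R : Type} [CommRing R] {N : Type} [AddCommGroup N] [Module R N]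
    {r : ℕ} (h : HasRank R N r) : HasStableRank R N r :=
  ⟨r, 0, by simp, ⟨LinearEquiv.prodUnique.trans h.some⟩⟩

instance nontrivial_localization_nonZeroDivisors (R : Type) [CommRing R] [Nontrivial R] :
    Nontrivial (Localization (nonZeroDivisors R)) :=
  (IsLocalization.injective (R := R) (M := nonZeroDivisors R) _ le_rfl).nontrivial

theorem HasStableRank.nonneg {R : Type} [CommRing R] [Nontrivial R] {N : Type} [AddCommGroup N]
    [Module R N] {s : ℤ} (h : HasStableRank R N s) : 0 ≤ s := by
  obtain ⟨m, n, rfl, ⟨e⟩⟩ := h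
  have : n ≤ m := le_of_fin_injective (Localization (nonZeroDivisors R))
    (e.toLinearMap ∘ₗ LinearMap.inr _ _ _) (e.injective.comp LinearMap.inr_injective)
  omega

theorem HasStableRank.eq_zero_of_subsingleton {R : Type} [CommRing R] [Nontrivial R] {N : Type}
    [AddCommGroup N] [Module R N] [Subsingleton N] {s : ℤ} (h : HasStableRank R N s) : s = 0 := by
  obtain ⟨m, n, rfl, ⟨e⟩⟩ := h
  have : Subsingleton (LocalizedModule (nonZeroDivisors R) N) := by
    rw [LocalizedModule.subsingleton_iff]
    exact fun x => ⟨1, one_mem _, Subsingleton.elim _ _⟩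
  have : Unique (LocalizedModule (nonZeroDivisors R) N) := ⟨⟨0⟩, fun _ => Subsingleton.elim _ _⟩
  have : n = m := eq_of_fin_equiv (Localization (nonZeroDivisors R))
    (LinearEquiv.uniqueProd.symm.trans e)
  omega

/-- A submodule of a free module with stable rank zero vanishes. -/
theorem HasStableRank.subsingleton {R : Type} [CommRing R] {N : Type} [AddCommGroup N]
    [Module R N] (h : HasStableRank R N 0) {b : ℕ} (f : N →ₗ[R] (Fin b → R))
    (hf : Function.Injective f) : Subsingleton N := by
  obtain ⟨m, n, hmn, ⟨e⟩⟩ := h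
  obtain rfl : m = n := by omega
  have hinj := OrzechProperty.injective_of_surjective_endomorphism
    (LinearMap.snd (Localization (nonZeroDivisors R)) (LocalizedModule (nonZeroDivisors R) N) _ ∘ₗ
      e.symm.toLinearMap)
    (Prod.snd_surjective.comp e.symm.surjective)
  refine subsingleton_of_forall_eq 0 fun y => hf ?_
  have hy : LocalizedModule.mkLinearMap (nonZeroDivisors R) N y = 0 := by
    have := @hinj (e (LocalizedModule.mkLinearMap (nonZeroDivisors R) N y, 0)) 0 (by simp)
    simpa using this
  obtain ⟨c, hc⟩ := (IsLocalizedModule.eq_zero_iff (nonZeroDivisors R)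
    (LocalizedModule.mkLinearMap (nonZeroDivisors R) N)).mp hy
  ext i
  have hci : (c : R) * f y i = 0 := by
    simpa using congrFun ((map_smul f (c : R) y).symm.trans (congrArg f hc)) i
  simpa using (mul_left_mem_nonZeroDivisors_eq_zero_iff c.2).mp hci

theorem Function.Exact.nonempty_prod_equiv {Q A B C : Type} [CommRing Q] [AddCommGroup A]
    [Module Q A] [AddCommGroup B] [Module Q B] [AddCommGroup C] [Module Q C]
    {f : A →ₗ[Q] B} {g : B →ₗ[Q] C} (h : Function.Exact f g) (hf : Function.Injective f)
    (hg : Function.Surjective g) {b m n : ℕ} (eB : B ≃ₗ[Q] (Fin b → Q))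
    (eC : (C × (Fin n → Q)) ≃ₗ[Q] (Fin m → Q)) :
    Nonempty ((A × (Fin m → Q)) ≃ₗ[Q] (Fin (b + n) → Q)) := by
  let f' : A →ₗ[Q] (B × (Fin n → Q)) := LinearMap.inl _ _ _ ∘ₗ f
  let g' : (B × (Fin n → Q)) →ₗ[Q] (Fin m → Q) := eC.toLinearMap ∘ₗ g.prodMap LinearMap.id
  have hg' : Function.Surjective g' :=
    eC.surjective.comp (Prod.map_surjective.mpr ⟨hg, Function.surjective_id⟩)
  have hf' : Function.Injective f' := LinearMap.inl_injective.comp hf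
  have h' : Function.Exact f' g' := by
    rintro ⟨x, y⟩
    simp only [f', g', LinearMap.comp_apply, LinearEquiv.coe_coe, LinearEquiv.map_eq_zero_iff,
      LinearMap.prodMap_apply, LinearMap.id_apply, Prod.mk_eq_zero, h x, Set.mem_range,
      LinearMap.inl_apply, Prod.mk.injEq]
    constructor
    · rintro ⟨⟨a, rfl⟩, rfl⟩
      exact ⟨a, rfl, rfl⟩
    · rintro ⟨a, rfl, rfl⟩
      exact ⟨⟨a, rfl⟩, rfl⟩
  obtain ⟨l, hl⟩ := Module.projective_lifting_property g' LinearMap.id hg'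
  let e := (h'.splitSurjectiveEquiv hf' ⟨l, hl⟩).1
  exact ⟨e.symm.trans <| (eB.prodCongr (LinearEquiv.refl _ _)).trans <|
    (LinearEquiv.sumArrowLequivProdArrow _ _ Q Q).symm.trans
      (LinearEquiv.funCongrLeft Q Q finSumFinEquiv.symm)⟩

theorem HasStableRank.ker {R : Type} [CommRing R] {N M : Type} [AddCommGroup N] [Module R N]
    [AddCommGroup M] [Module R M] {b : ℕ} {f : N →ₗ[R] (Fin b → R)} {g : (Fin b → R) →ₗ[R] M}
    (h : Function.Exact f g) (hf : Function.Injective f) (hg : Function.Surjective g) {s : ℤ}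
    (hs : HasStableRank R M s) : HasStableRank R N (b - s) := by
  obtain ⟨m, n, rfl, ⟨e⟩⟩ := hs
  refine ⟨b + n, m, by push_cast; ring, ?_⟩
  let S := nonZeroDivisors R
  have eB : LocalizedModule S (Fin b → R) ≃ₗ[Localization S] (Fin b → Localization S) :=
    (IsLocalizedModule.linearEquiv S (LocalizedModule.mkLinearMap S (Fin b → R))
      (LinearMap.pi fun i => Algebra.linearMap R (Localization S) ∘ₗ
        LinearMap.proj i)).extendScalarsOfIsLocalization S _
  exact Function.Exact.nonempty_prod_equiv (f := LocalizedModule.map S f)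
    (g := LocalizedModule.map S g) (LocalizedModule.map_exact S f g h)
    (LocalizedModule.map_injective S f hf) (LocalizedModule.map_surjective S g hg) eB e

/-- The syzygies of a minimal free resolution of `syz 0` by finite free modules. -/
structure SyzygyTower (R : Type) [CommRing R] [IsLocalRing R] where
  syz : ℕ → ModuleCat.{0} R
  rk : ℕ → ℕ
  cover (n : ℕ) : (Fin (rk n) → R) →ₗ[R] syz n
  incl (n : ℕ) : syz (n + 1) →ₗ[R] (Fin (rk n) → R)
  cover_surjective (n : ℕ) : Function.Surjective (cover n)
  incl_injective (n : ℕ) : Function.Injective (incl n)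
  exact (n : ℕ) : Function.Exact (incl n) (cover n)
  minimal (n : ℕ) (x : syz (n + 1)) (i : Fin (rk n)) : incl n x i ∈ maximalIdeal R

theorem SyzygyTower.exists_syz_zero_eq {R : Type} [CommRing R] [IsLocalRing R]
    [IsNoetherianRing R] (M : ModuleCat.{0} R) [Module.Finite R M] :
    ∃ T : SyzygyTower R, T.syz 0 = M := by
  choose b f hf hm using fun N : {N : ModuleCat.{0} R // Module.Finite R N} =>
    have := N.2
    exists_minimal_cover R N.1
  let next (N : {N : ModuleCat.{0} R // Module.Finite R N}) :
      {N : ModuleCat.{0} R // Module.Finite R N} :=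
    ⟨ModuleCat.of R (LinearMap.ker (f N)),
      inferInstanceAs (Module.Finite R (LinearMap.ker (f N)))⟩
  let s (n : ℕ) : {N : ModuleCat.{0} R // Module.Finite R N} :=
    Nat.rec ⟨M, inferInstance⟩ (fun _ => next) n
  exact ⟨{
    syz n := (s n).1
    rk n := b (s n)
    cover n := f (s n)
    incl n := (LinearMap.ker (f (s n))).subtype
    cover_surjective n := hf (s n)
    incl_injective n := Subtype.val_injective
    exact n := LinearMap.exact_subtype_ker_map (f (s n))
    minimal n x i := hm (s n) x.1 x.2 i }, rfl⟩

namespace SyzygyTower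

variable {R : Type} [CommRing R] [IsLocalRing R] (T : SyzygyTower R)

/-- The minimal free resolution attached to a tower of syzygies. -/
def complex : ChainComplex (ModuleCat.{0} R) ℕ :=
  ChainComplex.of (fun n => ModuleCat.of R (Fin (T.rk n) → R))
    (fun n => ModuleCat.ofHom (T.incl n ∘ₗ T.cover (n + 1))) fun n => by
      ext1
      refine LinearMap.ext fun x => ?_
      change T.incl n (T.cover (n + 1) (T.incl (n + 1) (T.cover (n + 2) x))) = 0
      rw [(T.exact (n + 1)).apply_apply_eq_zero, map_zero]

theorem complex_d (n : ℕ) :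
    T.complex.d (n + 1) n = ModuleCat.ofHom (T.incl n ∘ₗ T.cover (n + 1)) :=
  ChainComplex.of_d (fun n => ModuleCat.of R (Fin (T.rk n) → R))
    (fun n => ModuleCat.ofHom (T.incl n ∘ₗ T.cover (n + 1))) n

theorem exact_comp_cover (n : ℕ) :
    Function.Exact (T.incl n ∘ₗ T.cover (n + 1)) (T.cover n) := fun x => by
  rw [T.exact n x]
  simp [(T.cover_surjective (n + 1)).exists]

theorem complex_exactAt_succ (n : ℕ) : T.complex.ExactAt (n + 1) := by
  rw [HomologicalComplex.exactAt_iff' _ (n + 1 + 1) (n + 1) n (by simp) (by simp)]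
  rw [ShortComplex.moduleCat_exact_iff]
  change ∀ x, T.complex.d (n + 1) n x = 0 → ∃ y, T.complex.d (n + 1 + 1) (n + 1) y = x
  rw [complex_d, complex_d]
  intro x hx
  exact (T.exact_comp_cover (n + 1) x).mp (T.incl_injective n (hx.trans (map_zero _).symm))

/-- The minimal free resolution attached to a tower of syzygies. -/
noncomputable def projectiveResolution : ProjectiveResolution (T.syz 0) where
  complex := T.complex
  projective n := inferInstanceAs (Projective (ModuleCat.of R (Fin (T.rk n) → R)))
  π := (ChainComplex.toSingle₀Equiv _ _).symm ⟨ModuleCat.ofHom (T.cover 0), by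
    rw [complex_d]
    ext1
    exact (T.exact_comp_cover 0).linearMap_comp_eq_zero⟩
  quasiIso := ⟨fun n => by
    cases n
    · rw [ChainComplex.quasiIsoAt₀_iff, ShortComplex.quasiIso_iff_of_zeros']
      · refine (ShortComplex.exact_and_epi_g_iff_of_iso
          (S₂ := ShortComplex.mk (ModuleCat.ofHom (T.incl 0 ∘ₗ T.cover 1))
            (ModuleCat.ofHom (T.cover 0))
            (by ext1; exact (T.exact_comp_cover 0).linearMap_comp_eq_zero)) ?_).2
          ⟨?_, ?_⟩
        · exact ShortComplex.isoMk (Iso.refl _) (Iso.refl _) (Iso.refl _)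
            (by simp [complex_d]; rfl) (by simp; rfl)
        · rw [ShortComplex.moduleCat_exact_iff]
          exact fun x hx => (T.exact_comp_cover 0 x).mp hx
        · exact (ModuleCat.epi_iff_surjective _).mpr (T.cover_surjective 0)
      all_goals rfl
    · rw [quasiIsoAt_iff_exactAt']
      · apply complex_exactAt_succ
      · apply ChainComplex.exactAt_succ_single_obj⟩

theorem hasBetti (n : ℕ) : HasBetti R (T.syz 0) n (T.rk n) := by
  let F := (MonoidalCategory.tensoringLeft (ModuleCat.{0} R)).obj
    (ModuleCat.of R (ResidueField R))
  let K := (F.mapHomologicalComplex (ComplexShape.down ℕ)).obj T.complex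
  have hd (i j : ℕ) : K.d i j = 0 := by
    change F.map (T.complex.d i j) = 0
    by_cases hij : i = j + 1
    · subst hij
      rw [complex_d]
      ext1
      exact lTensor_residueField_eq_zero R _ fun x i => T.minimal j _ i
    · rw [T.complex.shape i j (fun h => hij h.symm), F.map_zero]
  exact ⟨T.projectiveResolution.isoLeftDerivedObj F n ≪≫
    (K.isoHomologyπ _ n rfl (hd _ _)).symm ≪≫ K.iCyclesIso n _ rfl (hd _ _) ≪≫
    (TensorProduct.piScalarRight R R (ResidueField R) (Fin (T.rk n))).toModuleIso⟩

theorem hasStableRank_succ {n : ℕ} {s : ℤ} (h : HasStableRank R (T.syz n) s) :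
    HasStableRank R (T.syz (n + 1)) (T.rk n - s) :=
  h.ker (T.exact n) (T.incl_injective n) (T.cover_surjective n)

theorem hasStableRank {r : ℤ} (h : HasStableRank R (T.syz 0) r) (n : ℕ) :
    HasStableRank R (T.syz (n + 1))
      (∑ j ∈ Finset.Icc 1 (n + 1), (-1) ^ (j - 1) * (T.rk (n + 1 - j) : ℤ) +
        (-1) ^ (n + 1) * r) := by
  induction n with
  | zero => simpa [sub_eq_add_neg] using T.hasStableRank_succ h
  | succ n ih =>
    have key := T.hasStableRank_succ ih
    rw [← Finset.Ico_add_one_right_eq_Icc, Finset.sum_Ico_eq_sum_range] at key ⊢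
    rw [Nat.add_sub_cancel] at key ⊢
    rw [Finset.sum_range_succ']
    have h0 (j : ℕ) : (-1 : ℤ) ^ (1 + (j + 1) - 1) * (T.rk (n + 1 + 1 - (1 + (j + 1))) : ℤ) =
        -((-1) ^ (1 + j - 1) * (T.rk (n + 1 - (1 + j)) : ℤ)) := by
      rw [show 1 + (j + 1) - 1 = 1 + j - 1 + 1 by omega,
        show n + 1 + 1 - (1 + (j + 1)) = n + 1 - (1 + j) by omega, pow_succ]
      ring
    rw [Finset.sum_congr rfl fun j _ => h0 j, Finset.sum_neg_distrib]
    convert key using 1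
    simp [pow_succ]
    ring

theorem rk_eq_zero_iff (n : ℕ) : T.rk n = 0 ↔ Subsingleton (T.syz n) := by
  constructor
  · intro h
    have : IsEmpty (Fin (T.rk n)) := by rw [h]; infer_instance
    exact (T.cover_surjective n).subsingleton
  · intro h
    by_contra hn
    have i : Fin (T.rk n) := ⟨0, Nat.pos_of_ne_zero hn⟩
    obtain ⟨y, hy⟩ := (T.exact n (Pi.single i 1)).mp (Subsingleton.elim _ _)
    have := T.minimal n y i
    rw [hy, Pi.single_eq_same] at this
    exact (Ideal.ne_top_iff_one _).mp (maximalIdeal.isMaximal R).ne_top this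

end SyzygyTower

theorem HasBetti.unique {R : Type} [CommRing R] [IsLocalRing R] {M : ModuleCat.{0} R} {j b c : ℕ}
    (hb : HasBetti R M j b) (hc : HasBetti R M j c) : b = c := by
  obtain ⟨e⟩ := hb
  obtain ⟨f⟩ := hc
  exact eq_of_fin_equiv (ResidueField R) <| LinearEquiv.extendScalarsOfSurjective
    (Ideal.Quotient.mk_surjective : Function.Surjective (algebraMap R (ResidueField R)))
    (e.symm ≪≫ f).toLinearEquiv

theorem stmt4 (R : Type) [CommRing R] [IsNoetherianRing R] [IsLocalRing R]
    (M : Type) [AddCommGroup M] [Module R M] [Module.Finite R M]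
    (r : ℕ) (hr : HasRank R M r)
    (β : ℕ → ℕ) (hβ : ∀ j, HasBetti R (ModuleCat.of R M) j (β j)) (i : ℕ) :
    (β i : ℤ) - (β (i+1) : ℤ) ≤
      (∑ j ∈ Finset.Icc 1 i, (-1)^(j-1) * (β (i-j) : ℤ)) + (-1)^i * r ∧
    ((β i : ℤ) - (β (i+1) : ℤ) =
      (∑ j ∈ Finset.Icc 1 i, (-1)^(j-1) * (β (i-j) : ℤ)) + (-1)^i * r ↔
      β (i+2) = 0) := by
  obtain ⟨T, hT⟩ := SyzygyTower.exists_syz_zero_eq (ModuleCat.of R M)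
  have h0 : HasStableRank R (T.syz 0) r := by
    rw [hT]
    exact hr.hasStableRank
  have hrk (n : ℕ) : β n = T.rk n := (hβ n).unique (hT ▸ T.hasBetti n)
  simp only [hrk]
  have hs := T.hasStableRank_succ (T.hasStableRank_succ (n := i) (s := ∑ j ∈ Finset.Icc 1 i,
    (-1) ^ (j - 1) * (T.rk (i - j) : ℤ) + (-1) ^ i * r) ?_)
  · rw [T.rk_eq_zero_iff]
    refine ⟨by linarith [hs.nonneg], fun h => ?_, fun h => ?_⟩
    · rw [← h, sub_sub_cancel, sub_self] at hs
      exact hs.subsingleton (T.incl (i + 1)) (T.incl_injective (i + 1))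
    · have := hs.eq_zero_of_subsingleton
      linarith
  · cases i with
    | zero => simpa using h0
    | succ i => exact T.hasStableRank h0 i
end

section
/- Let R be a Gorenstein local ring and I an ideal with β_1^R(I) - β_0^R(I) = -1 and β_1^R(I) ≠ 0. Then pd_R(I) = 1, and either I is a perfect ideal of grade 2, or I is not unmixed and grade(I) = 1. -/
open CategoryTheory IsLocalRing RingTheory.Sequence

namespace CategoryTheory.ProjectiveResolution

open Limits

universe v u

variable {C : Type u} [Category.{v} C] [Abelian C]

/-- The augmentation of a projective resolution. -/
noncomputable def aug {K : C} (Q : ProjectiveResolution K) : Q.complex.X 0 ⟶ K := Q.π.f 0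

instance {K : C} (Q : ProjectiveResolution K) : Epi Q.aug :=
  inferInstanceAs (Epi (Q.π.f 0))

lemma d_comp_aug {K : C} (Q : ProjectiveResolution K) : Q.complex.d 1 0 ≫ Q.aug = 0 :=
  Q.complex_d_comp_π_f_zero

lemma exact_aug {K : C} (Q : ProjectiveResolution K) :
    (ShortComplex.mk _ _ Q.d_comp_aug).Exact := Q.exact₀

lemma d_comp_aug_comp {K P : C} (Q : ProjectiveResolution K) (i : K ⟶ P) :
    Q.complex.d 1 0 ≫ Q.aug ≫ i = 0 := by
  rw [← Category.assoc, d_comp_aug, zero_comp]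

lemma aug_comp_comp {K P M : C} (Q : ProjectiveResolution K) (i : K ⟶ P) (p : P ⟶ M)
    (w : i ≫ p = 0) : (Q.aug ≫ i) ≫ p = 0 := by
  rw [Category.assoc, w, comp_zero]

/-- The complex underlying `splice`. -/
noncomputable def spliceComplex {K P : C} (i : K ⟶ P) (Q : ProjectiveResolution K) :
    ChainComplex C ℕ :=
  Q.complex.augment (Q.aug ≫ i) (Q.d_comp_aug_comp i)

lemma spliceComplex_d_one_zero {K P : C} (i : K ⟶ P) (Q : ProjectiveResolution K) :
    (spliceComplex i Q).d 1 0 = Q.aug ≫ i :=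
  ChainComplex.augment_d_one_zero _ _ _

lemma spliceComplex_d_succ_succ {K P : C} (i : K ⟶ P) (Q : ProjectiveResolution K) (a b : ℕ) :
    (spliceComplex i Q).d (a + 1) (b + 1) = Q.complex.d a b :=
  ChainComplex.augment_d_succ_succ _ _ _ _ _

/-- The augmentation underlying `splice`. -/
noncomputable def spliceπ {K P M : C} (i : K ⟶ P) (p : P ⟶ M) (w : i ≫ p = 0)
    (Q : ProjectiveResolution K) : spliceComplex i Q ⟶ (ChainComplex.single₀ C).obj M :=
  (ChainComplex.toSingle₀Equiv _ _).symm ⟨p, by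
    rw [spliceComplex_d_one_zero]
    exact Q.aug_comp_comp i p w⟩

lemma spliceπ_f_zero {K P M : C} (i : K ⟶ P) (p : P ⟶ M) (w : i ≫ p = 0)
    (Q : ProjectiveResolution K) : (spliceπ i p w Q).f 0 = p :=
  ChainComplex.toSingle₀Equiv_symm_apply_f_zero (C := spliceComplex i Q) (X := M) p _

/-- Prepend a projective object `P` mapping onto `M` with kernel `i : K ⟶ P` to a projective
resolution of `K`. -/
noncomputable def splice {K P M : C} [Projective P] (i : K ⟶ P) (p : P ⟶ M)
    (w : i ≫ p = 0) (hS : (ShortComplex.mk i p w).ShortExact)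
    (Q : ProjectiveResolution K) : ProjectiveResolution M where
  complex := spliceComplex i Q
  projective n := by
    cases n with
    | zero => exact inferInstanceAs (Projective P)
    | succ n => exact Q.projective n
  π := spliceπ i p w Q
  quasiIso := ⟨fun n => by
    have : Mono i := hS.mono_f
    have : Epi p := hS.epi_g
    have w' := Q.aug_comp_comp i p w
    have hex : (ShortComplex.mk (Q.aug ≫ i) p w').Exact := by
      let α : ShortComplex.mk (Q.aug ≫ i) p w' ⟶ ShortComplex.mk i p w :=
        { τ₁ := Q.aug
          τ₂ := 𝟙 _
          τ₃ := 𝟙 _ }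
      have : Epi α.τ₁ := inferInstanceAs (Epi Q.aug)
      exact (ShortComplex.exact_iff_of_epi_of_isIso_of_mono α).2 hS.exact
    match n with
    | 0 =>
      rw [ChainComplex.quasiIsoAt₀_iff, ShortComplex.quasiIso_iff_of_zeros']
      · refine (ShortComplex.exact_and_epi_g_iff_of_iso ?_).2 ⟨hex, by dsimp; infer_instance⟩
        refine ShortComplex.isoMk (Iso.refl _) (Iso.refl _) (Iso.refl _) ?_ ?_
        · exact (Category.id_comp _).trans ((spliceComplex_d_one_zero i Q).symm.trans
            (Category.comp_id _).symm)
        · exact (Category.id_comp _).trans ((spliceπ_f_zero i p w Q).symm.trans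
            (Category.comp_id _).symm)
      all_goals rfl
    | 1 =>
      rw [quasiIsoAt_iff_exactAt']
      · rw [HomologicalComplex.exactAt_iff' _ 2 1 0 (by simp) (by simp)]
        have h1 : (ShortComplex.mk (Q.complex.d 1 0) (Q.aug ≫ i) (Q.d_comp_aug_comp i)).Exact := by
          let α : ShortComplex.mk (Q.complex.d 1 0) Q.aug Q.d_comp_aug ⟶
              ShortComplex.mk (Q.complex.d 1 0) (Q.aug ≫ i) (Q.d_comp_aug_comp i) :=
            { τ₁ := 𝟙 _
              τ₂ := 𝟙 _
              τ₃ := i }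
          exact (ShortComplex.exact_iff_of_epi_of_isIso_of_mono α).1 Q.exact_aug
        exact h1
      · apply ChainComplex.exactAt_succ_single_obj
    | n + 2 =>
      rw [quasiIsoAt_iff_exactAt']
      · rw [HomologicalComplex.exactAt_iff' _ (n + 3) (n + 2) (n + 1) (by simp) (by simp)]
        exact Q.exact_succ n
      · apply ChainComplex.exactAt_succ_single_obj⟩

variable {D : Type*} [Category* D] [Abelian D]

/-- If a functor kills the differentials of a projective resolution around degree `n`, its `n`-th
left derived functor is its value on the `n`-th term. -/
lemma nonempty_leftDerived_iso_of_d_eq_zero [HasProjectiveResolutions C] {M : C}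
    (P : ProjectiveResolution M) (F : C ⥤ D) [F.Additive] (n : ℕ)
    (h₁ : F.map (P.complex.d (n + 1) n) = 0)
    (h₂ : ∀ m, F.map (P.complex.d n m) = 0) :
    Nonempty ((F.leftDerived n).obj M ≅ F.obj (P.complex.X n)) := by
  let K := (F.mapHomologicalComplex (ComplexShape.down ℕ)).obj P.complex
  have hf : (K.sc' (n + 1) n ((ComplexShape.down ℕ).next n)).f = 0 := h₁
  have hg : (K.sc' (n + 1) n ((ComplexShape.down ℕ).next n)).g = 0 := h₂ _
  exact ⟨P.isoLeftDerivedObj F n ≪≫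
    (ShortComplex.homologyMapIso (K.isoSc' (n + 1) n _ (by simp) rfl)) ≪≫
    (ShortComplex.HomologyData.ofZeros _ hf hg).left.homologyIso⟩

/-- Vanishing of `Ext` in positive degree lets cocycles on a projective resolution be extended. -/
lemma exists_eq_d_comp_of_isZero_ext {R : Type*} [Ring R] [Linear R C] [EnoughProjectives C]
    {M : C} (P : ProjectiveResolution M) (n : ℕ) (N : C)
    (h : IsZero (((Ext R C (n + 1)).obj (Opposite.op M)).obj N))
    (g : P.complex.X (n + 1) ⟶ N) (hg : P.complex.d (n + 2) (n + 1) ≫ g = 0) :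
    ∃ r : P.complex.X n ⟶ N, P.complex.d (n + 1) n ≫ r = g := by
  have h' := IsZero.of_iso h (P.isoExt (R := R) (n + 1) N).symm
  rw [← HomologicalComplex.exactAt_iff_isZero_homology,
    HomologicalComplex.exactAt_iff' _ n (n + 1) (n + 2) (by simp) (by simp),
    ShortComplex.moduleCat_exact_iff] at h'
  exact h' g hg

lemma isZero_ext_of_isZero {R : Type*} [Ring R] [Linear R C] [EnoughProjectives C]
    {M : C} (P : ProjectiveResolution M) (n : ℕ) (N : C) (h : IsZero (P.complex.X n)) :
    IsZero (((Ext R C n).obj (Opposite.op M)).obj N) := by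
  refine IsZero.of_iso ?_ (P.isoExt n N)
  rw [← HomologicalComplex.exactAt_iff_isZero_homology, HomologicalComplex.exactAt_iff]
  refine ShortComplex.exact_of_isZero_X₂ _ ?_
  rw [IsZero.iff_id_eq_zero]
  ext (x : _ ⟶ _)
  obtain rfl : x = 0 := h.eq_of_src _ _
  rfl

end CategoryTheory.ProjectiveResolution

section MinimalPresentation

open IsLocalRing TensorProduct

/-- A short exact sequence of modules gives one in `ModuleCat`. -/
lemma ModuleCat.shortExact_of_exact {R : Type*} [Ring R] {K P M : Type} [AddCommGroup K]
    [AddCommGroup P] [AddCommGroup M] [Module R K] [Module R P] [Module R M]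
    {i : K →ₗ[R] P} {p : P →ₗ[R] M} (hi : Function.Injective i) (hp : Function.Surjective p)
    (h : Function.Exact i p) (w : ModuleCat.ofHom i ≫ ModuleCat.ofHom p = 0) :
    (ShortComplex.mk (ModuleCat.ofHom i) (ModuleCat.ofHom p) w).ShortExact where
  exact := (ShortComplex.ShortExact.moduleCat_exact_iff_function_exact _).2 h
  mono_f := (ModuleCat.mono_iff_injective _).2 hi
  epi_g := (ModuleCat.epi_iff_surjective _).2 hp

variable {R : Type} [CommRing R] [IsLocalRing R]

lemma exists_surjective_ker_le_smul_top (M : Type) [AddCommGroup M] [Module R M]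
    [Module.Finite R M] :
    ∃ (n : ℕ) (e : (Fin n → R) →ₗ[R] M), Function.Surjective e ∧
      LinearMap.ker e ≤ maximalIdeal R • ⊤ := by
  classical
  have hex : ∃ n : ℕ, ∃ e : (Fin n → R) →ₗ[R] M, Function.Surjective e :=
    Module.Finite.exists_fin' R M
  obtain ⟨e, he⟩ := Nat.find_spec hex
  have hmin := fun k => Nat.find_min (m := k) hex
  generalize Nat.find hex = n at e hmin
  refine ⟨n, e, he, fun v hv => ?_⟩
  have key : ∀ j, v j ∈ maximalIdeal R := by
    intro j
    by_contra hj
    have hu : IsUnit (v j) := by simpa using hj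
    obtain ⟨c, hc⟩ := hu.exists_left_inv
    cases n with
    | zero => exact j.elim0
    | succ n =>
      refine hmin n n.lt_succ_self
        ⟨e ∘ₗ LinearMap.pi (fun i : Fin (n + 1) =>
          (if h : ∃ k, j.succAbove k = i then LinearMap.proj h.choose else 0)), fun y => ?_⟩
      obtain ⟨w, rfl⟩ := he y
      refine ⟨fun k => (w - (w j * c) • v) (j.succAbove k), ?_⟩
      have hv' : e v = 0 := hv
      have : e (w - (w j * c) • v) = e w := by rw [map_sub, map_smul, hv', smul_zero, sub_zero]
      rw [← this, LinearMap.comp_apply]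
      congr 1
      ext i
      rw [LinearMap.pi_apply]
      split_ifs with h
      · simp only [LinearMap.proj_apply]
        rw [h.choose_spec]
      · have : i = j := by
          by_contra hij
          exact h (Fin.exists_succAbove_eq hij)
        subst this
        simp [mul_assoc, hc]
  rw [← Finset.univ_sum_single v]
  refine Submodule.sum_mem _ fun j _ => ?_
  have : (Pi.single j (v j) : Fin n → R) = v j • Pi.single j 1 := by
    rw [← Pi.single_smul]; simp
  rw [this]
  exact Submodule.smul_mem_smul (key j) trivial

lemma tensoringLeft_residueField_map_eq_zero {X Y : Type} [AddCommGroup X] [AddCommGroup Y]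
    [Module R X] [Module R Y] (f : ModuleCat.of R X ⟶ ModuleCat.of R Y)
    (hf : ∀ x, f.hom x ∈ (maximalIdeal R • ⊤ : Submodule R Y)) :
    ((MonoidalCategory.tensoringLeft (ModuleCat R)).obj
      (ModuleCat.of R (ResidueField R))).map f = 0 := by
  have key : ∀ (a : ResidueField R) (y : Y), y ∈ (maximalIdeal R • ⊤ : Submodule R Y) →
      a ⊗ₜ[R] y = 0 := by
    intro a y hy
    induction hy using Submodule.smul_induction_on' with
    | smul r hr n _ =>
      rw [← TensorProduct.smul_tmul, Algebra.smul_def]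
      have : algebraMap R (ResidueField R) r = 0 := by
        simpa [ResidueField.algebraMap_eq] using hr
      rw [this, zero_mul, TensorProduct.zero_tmul]
    | add x _ y _ hx hy => rw [TensorProduct.tmul_add, hx, hy, add_zero]
  ext x
  change (LinearMap.lTensor (ResidueField R) f.hom) x = 0
  induction x using TensorProduct.induction_on with
  | zero => rw [map_zero]
  | tmul a x => rw [LinearMap.lTensor_tmul]; exact key _ _ (hf x)
  | add x y hx hy => rw [map_add, hx, hy, add_zero]

lemma eq_of_iso_residueField {n b : ℕ}
    (h : Nonempty (((MonoidalCategory.tensoringLeft (ModuleCat R)).obj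
      (ModuleCat.of R (ResidueField R))).obj (ModuleCat.of R (Fin n → R)) ≅
        ModuleCat.of R (Fin b → ResidueField R))) : n = b := by
  obtain ⟨e⟩ := h
  let e₁ : (ResidueField R ⊗[R] (Fin n → R)) ≃ₗ[R] (Fin b → ResidueField R) := e.toLinearEquiv
  let e₂ := (TensorProduct.piScalarRight R R (ResidueField R) (Fin n)).symm.trans e₁
  have e₃ := LinearEquiv.extendScalarsOfSurjective
    (S := ResidueField R) (residue_surjective (R := R)) e₂
  simpa using e₃.finrank_eq

open ProjectiveResolution in
lemma exists_minimal_presentation [IsNoetherianRing R] (M : Type) [AddCommGroup M] [Module R M]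
    [Module.Finite R M] {b₀ b₁ : ℕ} (h₀ : HasBetti R (ModuleCat.of R M) 0 b₀)
    (h₁ : HasBetti R (ModuleCat.of R M) 1 b₁) :
    ∃ (ε : (Fin b₀ → R) →ₗ[R] M) (φ : (Fin b₁ → R) →ₗ[R] (Fin b₀ → R)),
      Function.Surjective ε ∧ Function.Exact φ ε ∧
      LinearMap.range φ ≤ maximalIdeal R • ⊤ := by
  obtain ⟨n, e, he, hke⟩ := exists_surjective_ker_le_smul_top (R := R) M
  obtain ⟨m, e', he', hke'⟩ := exists_surjective_ker_le_smul_top (R := R) (LinearMap.ker e)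
  have w : ModuleCat.ofHom (LinearMap.ker e).subtype ≫ ModuleCat.ofHom e = 0 := by
    ext x : 2; exact x.2
  have w' : ModuleCat.ofHom (LinearMap.ker e').subtype ≫ ModuleCat.ofHom e' = 0 := by
    ext x : 2; exact x.2
  have hS := ModuleCat.shortExact_of_exact (Submodule.injective_subtype _) he
    e.exact_subtype_ker_map w
  have hS' := ModuleCat.shortExact_of_exact (Submodule.injective_subtype _) he'
    e'.exact_subtype_ker_map w'
  have : Projective (ModuleCat.of R (Fin n → R)) := 
    (IsProjective.iff_projective _).1 inferInstance
  have : Projective (ModuleCat.of R (Fin m → R)) := 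
    (IsProjective.iff_projective _).1 inferInstance
  let Q := splice _ _ w' hS' (ProjectiveResolution.of _)
  let P := splice _ _ w hS Q
  have hQ : Q.aug = ModuleCat.ofHom e' := spliceπ_f_zero _ _ w' _
  let F := (MonoidalCategory.tensoringLeft (ModuleCat R)).obj (ModuleCat.of R (ResidueField R))
  have d10 : F.map (P.complex.d 1 0) = 0 := by
    have : P.complex.d 1 0 = ModuleCat.ofHom ((LinearMap.ker e).subtype ∘ₗ e') := by
      refine (spliceComplex_d_one_zero _ _).trans ?_
      rw [hQ]; rfl
    rw [this]
    exact tensoringLeft_residueField_map_eq_zero _ fun x => hke (e' x).2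
  have d21 : F.map (P.complex.d 2 1) = 0 := by
    have : P.complex.d 2 1 = (ProjectiveResolution.of _).aug ≫
        ModuleCat.ofHom (LinearMap.ker e').subtype := 
      (spliceComplex_d_succ_succ _ _ 1 0).trans (spliceComplex_d_one_zero _ _)
    rw [this]
    exact tensoringLeft_residueField_map_eq_zero _ fun x => hke' (Subtype.property _)
  have n0 : n = b₀ := by
    obtain ⟨i⟩ := h₀
    obtain ⟨j⟩ := nonempty_leftDerived_iso_of_d_eq_zero P F 0 d10
      (fun k => by rw [P.complex.shape _ _ (by simp), F.map_zero])
    exact eq_of_iso_residueField ⟨j.symm ≪≫ i⟩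
  have n1 : m = b₁ := by
    obtain ⟨i⟩ := h₁
    obtain ⟨j⟩ := nonempty_leftDerived_iso_of_d_eq_zero P F 1 d21
      (fun k => by
        rcases k with _ | k
        · exact d10
        · rw [P.complex.shape _ _ (by simp), F.map_zero])
    exact eq_of_iso_residueField ⟨j.symm ≪≫ i⟩
  subst n0 n1
  refine ⟨e, (LinearMap.ker e).subtype ∘ₗ e', he, ?_, ?_⟩
  · rw [LinearMap.exact_iff, LinearMap.range_comp, LinearMap.range_eq_top.2 he']
    simp
  · rintro _ ⟨x, rfl⟩
    exact hke (e' x).2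

end MinimalPresentation

section ProjectiveDimension

open IsLocalRing ProjectiveResolution

lemma apply_mem_of_mem_smul_top {R ι : Type*} [CommRing R] {J : Ideal R} {v : ι → R}
    (hv : v ∈ (J • ⊤ : Submodule R (ι → R))) (i : ι) : v i ∈ J := by
  induction hv using Submodule.smul_induction_on' with
  | smul r hr n _ => exact J.mul_mem_right _ hr
  | add x _ y _ hx hy => exact J.add_mem hx hy

variable {R : Type} [CommRing R] [IsLocalRing R]

lemma eq_zero_of_retraction {m : ℕ} {X : Type} [AddCommGroup X] [Module R X]
    (d : (Fin m → R) →ₗ[R] X) (r : X →ₗ[R] (Fin m → R)) (hr : r ∘ₗ d = LinearMap.id)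
    (hd : LinearMap.range d ≤ maximalIdeal R • ⊤) : m = 0 := by
  rcases m with _ | m
  · rfl
  have h1 : (Pi.single 0 1 : Fin (m + 1) → R) ∈
      (maximalIdeal R • ⊤ : Submodule R (Fin (m + 1) → R)) := by
    have : r (d (Pi.single 0 1)) = Pi.single 0 1 := LinearMap.congr_fun hr _
    rw [← this]
    have h2 := Submodule.mem_map_of_mem (f := r) (hd ⟨Pi.single 0 1, rfl⟩)
    rw [Submodule.map_smul''] at h2
    exact Submodule.smul_mono le_rfl le_top h2
  have := apply_mem_of_mem_smul_top h1 0
  simp at this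

/-- A projective resolution whose last nonzero term is free of positive rank in degree `n + 1`,
with last differential of entries in the maximal ideal, computes the projective dimension. -/
lemma projDimEq_of_projectiveResolution {M : ModuleCat R} (P : ProjectiveResolution M) {m n : ℕ}
    (hm : m ≠ 0) {X : Type} [AddCommGroup X] [Module R X] (d : (Fin m → R) →ₗ[R] X)
    (hd : LinearMap.range d ≤ maximalIdeal R • ⊤)
    (i : P.complex.X (n + 1) ≅ ModuleCat.of R (Fin m → R))
    (j : ModuleCat.of R X ≅ P.complex.X n)
    (hij : P.complex.d (n + 1) n = i.hom ≫ ModuleCat.ofHom d ≫ j.hom)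
    (hz : ∀ k > n + 1, Limits.IsZero (P.complex.X k)) : ProjDimEq R M (n + 1) := by
  refine ⟨fun k hk N => P.isZero_ext_of_isZero k N (hz k hk), fun k hk => ?_⟩
  by_contra! hlt
  obtain ⟨r, hr⟩ := P.exists_eq_d_comp_of_isZero_ext (R := R) n (ModuleCat.of R (Fin m → R))
    (hk (n + 1) hlt _) i.hom ((hz (n + 2) (by omega)).eq_of_src _ _)
  refine hm (eq_zero_of_retraction d (j.hom ≫ r).hom ?_ hd)
  have : ModuleCat.ofHom d ≫ j.hom ≫ r = 𝟙 _ := by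
    rw [← cancel_epi i.hom, Category.comp_id]
    rw [hij] at hr
    simpa using hr
  exact congrArg ModuleCat.Hom.hom this

lemma projDimEq_one {m n : ℕ} (hm : m ≠ 0) {M : Type} [AddCommGroup M] [Module R M]
    (ε : (Fin n → R) →ₗ[R] M) (φ : (Fin m → R) →ₗ[R] (Fin n → R))
    (hφ : Function.Injective φ) (hε : Function.Surjective ε) (hex : Function.Exact φ ε)
    (hmin : LinearMap.range φ ≤ maximalIdeal R • ⊤) : ProjDimEq R (ModuleCat.of R M) 1 := by
  have w : ModuleCat.ofHom φ ≫ ModuleCat.ofHom ε = 0 :=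
    ModuleCat.hom_ext (LinearMap.ext fun x => hex.apply_apply_eq_zero x)
  have hS := ModuleCat.shortExact_of_exact hφ hε hex w
  have : Projective (ModuleCat.of R (Fin n → R)) := (IsProjective.iff_projective _).1 inferInstance
  have : Projective (ModuleCat.of R (Fin m → R)) := (IsProjective.iff_projective _).1 inferInstance
  refine projDimEq_of_projectiveResolution (n := 0) (splice _ _ w hS (self _)) hm φ hmin
    (Iso.refl _) (Iso.refl _) ?_ fun k hk => ?_
  · refine (spliceComplex_d_one_zero _ _).trans ?_
    rfl
  · obtain ⟨k, rfl⟩ : ∃ l, k = l + 2 := ⟨k - 2, by omega⟩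
    exact HomologicalComplex.isZero_single_obj_X (ComplexShape.down ℕ) 0
      (ModuleCat.of R (Fin m → R)) (k + 1) (by simp)

lemma projDimEq_two {m n : ℕ} (hm : m ≠ 0) (I : Ideal R)
    (ε : (Fin n → R) →ₗ[R] I) (φ : (Fin m → R) →ₗ[R] (Fin n → R))
    (hφ : Function.Injective φ) (hε : Function.Surjective ε) (hex : Function.Exact φ ε)
    (hmin : LinearMap.range φ ≤ maximalIdeal R • ⊤) :
    ProjDimEq R (ModuleCat.of R (R ⧸ I)) 2 := by
  have w : ModuleCat.ofHom φ ≫ ModuleCat.ofHom ε = 0 :=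
    ModuleCat.hom_ext (LinearMap.ext fun x => hex.apply_apply_eq_zero x)
  have hS := ModuleCat.shortExact_of_exact hφ hε hex w
  have w' : ModuleCat.ofHom I.subtype ≫ ModuleCat.ofHom I.mkQ = 0 := by
    ext x : 2; exact (Submodule.Quotient.mk_eq_zero I).2 x.2
  have hS' := ModuleCat.shortExact_of_exact (Submodule.injective_subtype I)
    (Submodule.mkQ_surjective I) (LinearMap.exact_subtype_mkQ I) w'
  have : Projective (ModuleCat.of R (Fin n → R)) := (IsProjective.iff_projective _).1 inferInstance
  have : Projective (ModuleCat.of R (Fin m → R)) := (IsProjective.iff_projective _).1 inferInstance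
  have : Projective (ModuleCat.of R R) := (IsProjective.iff_projective _).1 inferInstance
  refine projDimEq_of_projectiveResolution (n := 1)
    (splice _ _ w' hS' (splice _ _ w hS (self _))) hm φ hmin
    (Iso.refl _) (Iso.refl _) ?_ fun k hk => ?_
  · refine (spliceComplex_d_succ_succ _ _ 1 0).trans ((spliceComplex_d_one_zero _ _).trans ?_)
    rfl
  · obtain ⟨k, rfl⟩ : ∃ l, k = l + 3 := ⟨k - 3, by omega⟩
    exact HomologicalComplex.isZero_single_obj_X (ComplexShape.down ℕ) 0
      (ModuleCat.of R (Fin m → R)) (k + 1) (by simp)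

end ProjectiveDimension

section CohenMacaulay

open Module Submodule
open scoped Pointwise

lemma ringKrullDim_quotient_succ_le_of_lt {R : Type*} [CommRing R] {p q : Ideal R} [p.IsPrime]
    (h : p < q) : ringKrullDim (R ⧸ q) + 1 ≤ ringKrullDim (R ⧸ p) := by
  obtain ⟨y, hyq, hyp⟩ := SetLike.exists_of_lt h
  refine ringKrullDim_succ_le_of_surjective (Ideal.Quotient.factor h.le)
    (Ideal.Quotient.factor_surjective h.le) (r := Ideal.Quotient.mk p y) ?_ ?_
  · rw [mem_nonZeroDivisors_iff_ne_zero]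
    rwa [ne_eq, Ideal.Quotient.eq_zero_iff_mem]
  · rwa [Ideal.Quotient.factor_mk, Ideal.Quotient.eq_zero_iff_mem]

variable {R : Type*} [CommRing R] [IsNoetherianRing R]

lemma exists_mem_associatedPrimes_quotSMulTop_of_mem_associatedPrimes {M : Type*} [AddCommGroup M]
    [Module R M] [Module.Finite R M] {x : R} (hx : x ∈ Ideal.jacobson (⊥ : Ideal R))
    (hreg : IsSMulRegular M x) {p : Ideal R} (hp : p ∈ associatedPrimes R M) :
    ∃ q ∈ associatedPrimes R (QuotSMulTop x M), p < q := by
  obtain ⟨hp', m, hm⟩ := isAssociatedPrime_iff.1 hp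
  have hpm (a : R) : a ∈ p ↔ a • m = 0 := by rw [hm, mem_colon_singleton, mem_bot]
  have hm0 : m ≠ 0 := fun h => hp'.ne_top ((Ideal.eq_top_iff_one p).2 ((hpm 1).2 (by simp [h])))
  have hxp : x ∉ p := fun h => hm0 (hreg.right_eq_zero_of_smul ((hpm x).1 h))
  obtain ⟨n, hn, hnx⟩ : ∃ n ∈ torsionBySet R M p, n ∉ x • (⊤ : Submodule R M) := by
    by_contra! H
    have h1 : torsionBySet R M p ≤ Ideal.span {x} • torsionBySet R M p := by
      intro n hn
      obtain ⟨n', -, rfl⟩ := (Submodule.mem_smul_pointwise_iff_exists _ _ _).1 (H n hn)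
      rw [ideal_span_singleton_smul]
      refine smul_mem_pointwise_smul _ _ _ ((mem_torsionBySet_iff _ _).2 fun a => ?_)
      have := (mem_torsionBySet_iff _ _).1 hn a
      rw [smul_comm] at this
      exact hreg.right_eq_zero_of_smul this
    have h2 := eq_bot_of_le_smul_of_le_jacobson_bot _ _ (IsNoetherian.noetherian _) h1
      ((Ideal.span_singleton_le_iff_mem _).2 hx)
    refine hm0 ((mem_bot R).1 (h2 ▸ (mem_torsionBySet_iff _ _).2 fun a => (hpm a).1 a.2))
  obtain ⟨q, hq, hle⟩ := exists_le_isAssociatedPrime_of_isNoetherianRing R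
    (Submodule.Quotient.mk (p := x • (⊤ : Submodule R M)) n)
    (by rwa [ne_eq, Submodule.Quotient.mk_eq_zero])
  refine ⟨q, hq, SetLike.lt_iff_le_and_exists.2 ⟨fun a ha => hle ?_, x, hle ?_, hxp⟩⟩
  · rw [mem_colon_singleton, mem_bot, ← Submodule.Quotient.mk_smul]
    rw [(mem_torsionBySet_iff _ _).1 hn ⟨a, ha⟩]
    rfl
  · rw [mem_colon_singleton, mem_bot, ← Submodule.Quotient.mk_smul, Submodule.Quotient.mk_eq_zero]
    exact smul_mem_pointwise_smul _ _ _ mem_top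

variable [IsLocalRing R]

/-- The length of a regular sequence on `M` is at most the dimension of `R ⧸ p` for every
associated prime `p` of `M`. -/
lemma length_le_ringKrullDim_quotient_of_mem_associatedPrimes (rs : List R) (M : Type*)
    [AddCommGroup M] [Module R M] [Module.Finite R M] (hrs : ∀ x ∈ rs, x ∈ maximalIdeal R)
    (hreg : IsWeaklyRegular M rs) {p : Ideal R} (hp : p ∈ associatedPrimes R M) :
    (rs.length : WithBot ℕ∞) ≤ ringKrullDim (R ⧸ p) := by
  induction rs generalizing M p with
  | nil =>
    have := hp.1
    simpa using ringKrullDim_nonneg_of_nontrivial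
  | cons x rs ih =>
    rw [isWeaklyRegular_cons_iff] at hreg
    rw [List.forall_mem_cons] at hrs
    obtain ⟨q, hq, hpq⟩ := exists_mem_associatedPrimes_quotSMulTop_of_mem_associatedPrimes
      (maximalIdeal_le_jacobson _ hrs.1) hreg.1 hp
    have := hp.1
    refine le_trans ?_ (ringKrullDim_quotient_succ_le_of_lt hpq)
    rw [List.length_cons, Nat.cast_add, Nat.cast_one]
    gcongr
    exact ih (QuotSMulTop x M) hrs.2 hreg.2 hq

lemma mem_minimalPrimes_of_mem_associatedPrimes_of_isCMLocalRing {R : Type} [CommRing R]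
    [IsNoetherianRing R] [IsLocalRing R] (hR : IsCMLocalRing R) {p : Ideal R}
    (hp : p ∈ associatedPrimes R R) : p ∈ minimalPrimes R := by
  obtain ⟨rs, hrs, hreg, hlen⟩ := hR
  have e : (R ⧸ (⊥ : Ideal R)) ≃ₗ[R] R := Submodule.quotEquivOfEqBot _ rfl
  have h1 := length_le_ringKrullDim_quotient_of_mem_associatedPrimes rs R hrs
    ((e.isWeaklyRegular_congr rs).1 hreg.toIsWeaklyRegular) hp
  replace h1 := hlen.ge.trans h1
  rw [ringKrullDim_eq_of_ringEquiv (RingEquiv.quotientBot R)] at h1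
  have := hp.1
  obtain ⟨q, hq, hqp⟩ := Ideal.exists_minimalPrimes_le (I := ⊥) (J := p) bot_le
  rcases hqp.eq_or_lt with rfl | hlt
  · exact hq
  have := hq.1.1
  have h2 := (ringKrullDim_quotient_succ_le_of_lt hlt).trans (ringKrullDim_quotient_le q)
  have h3 := h2.trans h1
  have h4 : ringKrullDim (R ⧸ p) < ringKrullDim (R ⧸ p) + 1 := by
    obtain ⟨n, hn⟩ : ∃ n : ℕ, ringKrullDim (R ⧸ p) = n := by
      obtain ⟨d, hd⟩ := WithBot.ne_bot_iff_exists.1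
        ((WithBot.bot_lt_coe (0 : ℕ∞)).trans_le
          (ringKrullDim_nonneg_of_nontrivial (R := R ⧸ p))).ne'
      obtain ⟨n, rfl⟩ := ENat.ne_top_iff_exists.1 fun h : d = ⊤ =>
        ((ringKrullDim_quotient_le p).trans_lt ringKrullDim_lt_top).ne (by rw [← hd, h]; rfl)
      exact ⟨n, hd.symm⟩
    rw [hn]
    exact_mod_cast Nat.lt_succ_self n
  exact absurd h3 h4.not_ge

end CohenMacaulay

section Injectivity

open Module LinearMap

/-- Over an Artinian ring, a complex of free modules `P → Q → S` which is exact at `Q` is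
left exact as soon as `rank Q = rank P + 1`. -/
lemma injective_of_exact_of_finrank_eq_succ {S : Type*} [CommRing S] [IsArtinianRing S]
    [Nontrivial S] {P Q L : Type*} [AddCommGroup P] [AddCommGroup Q] [AddCommGroup L] [Module S P]
    [Module S Q] [Module S L] [Module.Free S P] [Module.Free S Q] [Module.Free S L]
    [Module.Finite S P] [Module.Finite S Q] [Module.Finite S L] {φ : P →ₗ[S] Q} {ε : Q →ₗ[S] L}
    (hex : Function.Exact φ ε) (hL : finrank S L = 1) (h : finrank S Q = finrank S P + 1) :
    Function.Injective φ := by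
  have h1 : length S P = length S (ker φ) + length S (range φ) :=
    length_eq_add_of_exact (ker φ).subtype φ.rangeRestrict (Submodule.subtype_injective _)
      φ.surjective_rangeRestrict (by
        rw [LinearMap.exact_iff, ker_rangeRestrict, Submodule.range_subtype])
  have h2 : length S Q = length S (range φ) + length S (range ε) :=
    length_eq_add_of_exact (range φ).subtype ε.rangeRestrict (Submodule.subtype_injective _)
      ε.surjective_rangeRestrict (by
        rw [LinearMap.exact_iff, ker_rangeRestrict, Submodule.range_subtype, hex.linearMap_ker_eq])
  have h3 : length S (range ε) ≤ length S L :=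
    length_le_of_injective (range ε).subtype (Submodule.subtype_injective _)
  rw [length_of_free_of_finite (R := S) (M := L), hL, Nat.cast_one, one_mul] at h3
  rw [length_of_free_of_finite (R := S) (M := Q), h] at h2
  have h0 : length S P ≠ ⊤ := length_ne_top
  have h0' : length S S ≠ ⊤ := length_ne_top
  rw [length_of_free_of_finite (R := S) (M := P)] at h1 h0
  have h4 : length S (ker φ) = 0 := by
    generalize length S (ker φ) = k at *
    generalize length S (range φ) = r at *
    generalize length S (range ε) = t at *
    generalize length S S = l at *
    generalize finrank S P = m at *
    push_cast at h2
    rw [add_mul, one_mul, h1] at h2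
    rw [h1] at h0
    lift l to ℕ using h0'
    lift k to ℕ using fun h => h0 (by simp [h])
    lift r to ℕ using fun h => h0 (by simp [h])
    lift t to ℕ using fun h => by simp [h] at h3
    norm_cast at *
    omega
  rw [← ker_eq_bot]
  exact (Submodule.subsingleton_iff_eq_bot).1 (length_eq_zero_iff.1 h4)

variable {R : Type*} [CommRing R] [IsNoetherianRing R]

lemma associatedPrimes_pi_subset {ι : Type*} [Finite ι] :
    associatedPrimes R (ι → R) ⊆ associatedPrimes R R := by
  cases nonempty_fintype ι
  intro q hq
  obtain ⟨hq', v, hv⟩ := isAssociatedPrime_iff.1 hq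
  have h : ⨅ i, (⊥ : Submodule R R).colon {v i} = q := by
    ext a
    simp [hv, Submodule.mem_colon_singleton, funext_iff]
  obtain ⟨i, -, hi⟩ := (Ideal.IsPrime.inf_le' hq' (s := Finset.univ) (f := fun i =>
    (⊥ : Submodule R R).colon {v i})).1 (by rw [Finset.inf_univ_eq_iInf, h])
  exact isAssociatedPrime_iff.2 ⟨hq', v i, le_antisymm (h.ge.trans (iInf_le _ i)) hi⟩

lemma isArtinianRing_localization_atPrime_of_mem_minimalPrimes {q : Ideal R} [q.IsPrime]
    (hq : q ∈ minimalPrimes R) : IsArtinianRing (Localization.AtPrime q) := by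
  have := IsLocalization.isNoetherianRing q.primeCompl (Localization.AtPrime q) inferInstance
  rw [isArtinianRing_iff_krullDimLE_zero, Ring.krullDimLE_iff,
    IsLocalization.AtPrime.ringKrullDim_eq_height q, Ideal.height_eq_zero_iff.2 hq]
  rfl

/-- If all associated primes of `R` are minimal, then an exact sequence `Rᵐ → Rᵐ⁺¹ → R` is
left exact. -/
lemma injective_of_exact_of_associatedPrimes_subset
    (hR : associatedPrimes R R ⊆ minimalPrimes R) {m : ℕ} {φ : (Fin m → R) →ₗ[R] (Fin (m + 1) → R)}
    {ε : (Fin (m + 1) → R) →ₗ[R] R} (hex : Function.Exact φ ε) : Function.Injective φ := by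
  rw [← ker_eq_bot, ← Submodule.subsingleton_iff_eq_bot]
  by_contra hne
  rw [not_subsingleton_iff_nontrivial] at hne
  obtain ⟨q, hq⟩ := associatedPrimes.nonempty R (ker φ)
  have hqR := hR (associatedPrimes_pi_subset
    (associatedPrimes.subset_of_injective (ker φ).subtype_injective hq))
  obtain ⟨hq', v, hv⟩ := isAssociatedPrime_iff.1 hq
  have : Nontrivial R := not_subsingleton_iff_nontrivial.1 fun _ => hq'.ne_top
    (Subsingleton.elim _ _)
  have := isArtinianRing_localization_atPrime_of_mem_minimalPrimes hqR
  have hfree (n : ℕ) : Module.Free (Localization.AtPrime q)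
      (LocalizedModule q.primeCompl (Fin n → R)) :=
    Module.free_of_isLocalizedModule q.primeCompl (LocalizedModule.mkLinearMap _ _)
  have hfree' : Module.Free (Localization.AtPrime q) (LocalizedModule q.primeCompl R) :=
    Module.free_of_isLocalizedModule q.primeCompl (LocalizedModule.mkLinearMap _ _)
  have hrank (n : ℕ) : finrank (Localization.AtPrime q)
      (LocalizedModule q.primeCompl (Fin n → R)) = n := by
    rw [Module.finrank_of_isLocalizedModule_of_free (Localization.AtPrime q) q.primeCompl
      (LocalizedModule.mkLinearMap q.primeCompl (Fin n → R))]
    rw [finrank_fin_fun]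
  have hinj := injective_of_exact_of_finrank_eq_succ (S := Localization.AtPrime q)
    (φ := LocalizedModule.map q.primeCompl φ) (ε := LocalizedModule.map q.primeCompl ε)
    (LocalizedModule.map_exact q.primeCompl φ ε hex)
    (by
      rw [Module.finrank_of_isLocalizedModule_of_free (Localization.AtPrime q) q.primeCompl
        (LocalizedModule.mkLinearMap q.primeCompl R), finrank_self]) (by rw [hrank, hrank])
  have h0 : LocalizedModule.map q.primeCompl φ (LocalizedModule.mk v 1) =
      LocalizedModule.map q.primeCompl φ 0 := by
    rw [LocalizedModule.map_mk, v.2, map_zero, LocalizedModule.zero_mk]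
  obtain ⟨s, hs⟩ := LocalizedModule.mk_eq.1 ((hinj h0).trans (LocalizedModule.zero_mk 1).symm)
  refine s.2 (hv.ge ?_)
  rw [Submodule.mem_colon_singleton, Submodule.mem_bot]
  exact Subtype.ext (by simpa [Submonoid.smul_def] using hs)

end Injectivity

section HilbertBurch

open Matrix

variable {R : Type*} [CommRing R] {m : ℕ}

/-- The linear form on `Rᵐ⁺¹` sending `v` to the determinant with rows `v` and the images under
`φ` of the standard basis vectors; its values on the standard basis are the signed maximal minors
of `φ`. -/
def maximalMinors (φ : (Fin m → R) →ₗ[R] (Fin (m + 1) → R)) : (Fin (m + 1) → R) →ₗ[R] R where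
  toFun v := det (of (vecCons v fun j => φ (Pi.single j 1)))
  map_add' v w := (detRowAlternating (R := R) (n := Fin (m + 1))).toMultilinearMap.cons_add _ v w
  map_smul' a v := (detRowAlternating (R := R) (n := Fin (m + 1))).toMultilinearMap.cons_smul _ a v

variable (φ : (Fin m → R) →ₗ[R] (Fin (m + 1) → R))

lemma maximalMinors_apply (v : Fin (m + 1) → R) :
    maximalMinors φ v = det (of (vecCons v fun j => φ (Pi.single j 1))) :=
  rfl

lemma apply_eq_sum_smul_single (u : Fin m → R) : φ u = ∑ j, u j • φ (Pi.single j 1) := by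
  conv_lhs => rw [← Finset.univ_sum_single u, map_sum]
  refine Finset.sum_congr rfl fun j _ => ?_
  rw [← map_smul, ← Pi.single_smul, smul_eq_mul, mul_one]

lemma maximalMinors_comp : maximalMinors φ ∘ₗ φ = 0 := by
  refine LinearMap.pi_ext' fun j => LinearMap.ext_ring ?_
  exact det_zero_of_row_eq (i := 0) (j := j.succ) (Fin.succ_ne_zero j).symm rfl

/-- Cramer's rule for the maximal minors. -/
lemma maximalMinors_smul_sub_mem_range (v w : Fin (m + 1) → R) :
    maximalMinors φ w • v - maximalMinors φ v • w ∈ LinearMap.range φ := by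
  set M : Matrix (Fin (m + 1)) (Fin (m + 1)) R := of (vecCons w fun j => φ (Pi.single j 1)) with hM
  refine ⟨fun j => cramer Mᵀ v j.succ, ?_⟩
  have h1 := mulVec_cramer Mᵀ v
  have h2 : cramer Mᵀ v 0 = maximalMinors φ v := by
    rw [cramer_transpose_apply, maximalMinors_apply]
    congr 1
    ext i j
    refine Fin.cases ?_ (fun i => ?_) i <;> simp [hM, updateRow_apply]
  rw [det_transpose, mulVec_transpose, vecMul_eq_sum, Fin.sum_univ_succ, h2] at h1
  rw [maximalMinors_apply, ← hM, ← h1, apply_eq_sum_smul_single φ]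
  exact (add_sub_cancel_left _ _).symm

/-- If all maximal minors of `φ` lie in the prime `q`, then `φ` is not injective modulo `q`. -/
lemma exists_apply_mem_of_maximalMinors_mem {q : Ideal R} [q.IsPrime]
    (h : ∀ v, maximalMinors φ v ∈ q) : ∃ u, (∃ j, u j ∉ q) ∧ ∀ i, φ u i ∈ q := by
  let K := FractionRing (R ⧸ q)
  let f : R →+* K := algebraMap R K
  have hf (a : R) : f a = 0 ↔ a ∈ q := by
    change algebraMap R K a = 0 ↔ _
    rw [IsScalarTower.algebraMap_apply R (R ⧸ q) K, FaithfulSMul.algebraMap_eq_zero_iff]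
    exact Ideal.Quotient.eq_zero_iff_mem
  let c : Fin m → Fin (m + 1) → K := fun j i => f (φ (Pi.single j 1) i)
  have hdep : ¬ LinearIndependent K c := by
    intro hc
    obtain ⟨i, hi⟩ : ∃ i, (Pi.single i 1 : Fin (m + 1) → K) ∉ Submodule.span K (Set.range c) := by
      by_contra! H
      have h1 : Submodule.span K (Set.range c) = ⊤ := by
        rw [eq_top_iff, ← (Pi.basisFun K (Fin (m + 1))).span_eq, Submodule.span_le]
        rintro _ ⟨i, rfl⟩
        simpa using H i
      have h2 := finrank_range_le_card (R := K) (b := c)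
      rw [Set.finrank, h1] at h2
      simp at h2
    have h1 : LinearIndependent K (vecCons (Pi.single i 1) c : Fin (m + 1) → Fin (m + 1) → K) :=
      linearIndependent_finCons.2 ⟨hc, hi⟩
    have h2 := (linearIndependent_rows_iff_isUnit (A := of (vecCons (Pi.single i 1) c))).1 h1
    rw [isUnit_iff_isUnit_det] at h2
    refine h2.ne_zero ?_
    rw [← (hf _).2 (h (Pi.single i 1)), maximalMinors_apply, RingHom.map_det]
    congr 1
    ext k l
    refine Fin.cases ?_ (fun k => ?_) k
    · simp [Pi.single_apply, apply_ite f]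
    · simp [c]
  rw [← LinearIndependent.iff_fractionRing (R ⧸ q) K, Fintype.linearIndependent_iff] at hdep
  push Not at hdep
  obtain ⟨g, hg, j, hj⟩ := hdep
  choose u hu using fun j => Ideal.Quotient.mk_surjective (g j)
  refine ⟨u, ⟨j, ?_⟩, fun i => ?_⟩
  · rwa [← Ideal.Quotient.eq_zero_iff_mem, hu]
  · rw [← hf, apply_eq_sum_smul_single φ, Finset.sum_apply, map_sum]
    have := congrFun hg i
    rw [Finset.sum_apply] at this
    refine Eq.trans (Finset.sum_congr rfl fun k _ => ?_) this
    rw [← hu]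
    simp [c, Algebra.smul_def, f]
    exact Or.inl (IsScalarTower.algebraMap_apply R (R ⧸ q) K _)

lemma exists_isSMulRegular_quotient_maximalMinors [IsNoetherianRing R] {X : Ideal R}
    (hX : ∀ u, (∀ i, φ u i ∈ X) → ∀ j, u j ∈ X) :
    ∃ w, IsSMulRegular (R ⧸ X) (maximalMinors φ w) := by
  by_contra! H
  have h1 : (LinearMap.range (maximalMinors φ) : Set R) ⊆
      ⋃ p ∈ associatedPrimes R (R ⧸ X), (p : Set R) := by
    rw [biUnion_associatedPrimes_eq_zero_divisors]
    rintro _ ⟨w, rfl⟩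
    obtain ⟨x, hx, hx0⟩ := not_forall₂.1 (mt isSMulRegular_iff_right_eq_zero_of_smul.2 (H w))
    exact ⟨x, hx0, hx⟩
  obtain ⟨q, hq, hle⟩ := (Ideal.subset_union_prime_finite (associatedPrimes.finite R (R ⧸ X)) ⊥ ⊥
    (fun p hp _ _ => hp.1)).1 h1
  obtain ⟨hq', y, hy⟩ := isAssociatedPrime_iff.1 hq
  obtain ⟨y, rfl⟩ := Ideal.Quotient.mk_surjective y
  have hmem (a : R) : a ∈ q ↔ y * a ∈ X := by
    rw [hy, Submodule.mem_colon_singleton, Submodule.mem_bot, ← Ideal.Quotient.eq_zero_iff_mem,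
      Algebra.smul_def, map_mul, mul_comm]
    rfl
  obtain ⟨u, ⟨j, hj⟩, hu⟩ := exists_apply_mem_of_maximalMinors_mem φ (q := q)
    fun v => hle ⟨v, rfl⟩
  refine hj ((hmem _).2 (hX (y • u) (fun i => ?_) j))
  rw [map_smul]
  exact (hmem _).1 (hu i)

lemma maximalMinors_mem_maximalIdeal [IsLocalRing R] (hm : m ≠ 0)
    (hφ : LinearMap.range φ ≤ maximalIdeal R • ⊤) (v : Fin (m + 1) → R) :
    maximalMinors φ v ∈ maximalIdeal R := by
  obtain ⟨m, rfl⟩ := Nat.exists_eq_succ_of_ne_zero hm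
  rw [← residue_eq_zero_iff, maximalMinors_apply, RingHom.map_det]
  refine det_eq_zero_of_row_eq_zero 1 fun j => ?_
  exact (residue_eq_zero_iff _).2 (apply_mem_of_mem_smul_top (hφ ⟨_, rfl⟩) j)

variable {φ}

/-- The **Hilbert–Burch theorem**: if `0 → Rᵐ → Rᵐ⁺¹ → R` is exact then its second map is a
multiple of the vector of maximal minors of the first one, the multiplier is a nonzerodivisor,
and the ideal of maximal minors contains a regular sequence of length two. -/
theorem exists_eq_smul_maximalMinors [IsNoetherianRing R] {ε : (Fin (m + 1) → R) →ₗ[R] R}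
    (hφ : Function.Injective φ) (hex : Function.Exact φ ε) :
    ∃ (a : R) (w w' : Fin (m + 1) → R), ε = a • maximalMinors φ ∧ IsSMulRegular R a ∧
      IsSMulRegular R (maximalMinors φ w) ∧
      IsSMulRegular (R ⧸ Ideal.span {maximalMinors φ w}) (maximalMinors φ w') := by
  obtain ⟨w, hw⟩ := exists_isSMulRegular_quotient_maximalMinors φ (X := ⊥) fun u hu j => by
    have : u = 0 := hφ (by rw [map_zero]; exact funext hu)
    simp [this]
  replace hw : IsSMulRegular R (maximalMinors φ w) :=
    ((Submodule.quotEquivOfEqBot (⊥ : Ideal R) rfl).isSMulRegular_congr _).1 hw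
  obtain ⟨w', hw'⟩ := exists_isSMulRegular_quotient_maximalMinors φ
    (X := Ideal.span {maximalMinors φ w}) fun u hu j => by
      choose v hv using fun i => Ideal.mem_span_singleton.1 (hu i)
      have h1 : φ u = maximalMinors φ w • v := funext hv
      have h2 : ε v = 0 := hw.right_eq_zero_of_smul (by
        rw [← map_smul, ← h1, hex.apply_apply_eq_zero])
      obtain ⟨t, rfl⟩ := (hex v).1 h2
      rw [← map_smul] at h1
      exact Ideal.mem_span_singleton.2 ⟨t j, congrFun (hφ h1) j⟩
  have hcramer (v v' : Fin (m + 1) → R) :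
      maximalMinors φ v' * ε v = maximalMinors φ v * ε v' := by
    obtain ⟨t, ht⟩ := maximalMinors_smul_sub_mem_range φ v v'
    have := hex.apply_apply_eq_zero t
    rw [ht, map_sub, map_smul, map_smul, sub_eq_zero] at this
    exact this
  obtain ⟨a, ha⟩ : maximalMinors φ w ∣ ε w := by
    rw [← Ideal.mem_span_singleton, ← Ideal.Quotient.eq_zero_iff_mem]
    refine hw'.right_eq_zero_of_smul ?_
    have := (Ideal.Quotient.eq_zero_iff_mem (I := Ideal.span {maximalMinors φ w})).2
      (Ideal.mem_span_singleton.2 ⟨_, (hcramer w w')⟩)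
    exact this
  have hε : ε = a • maximalMinors φ := LinearMap.ext fun v => hw (by
    have := hcramer v w
    rw [ha] at this
    simp only [LinearMap.smul_apply, smul_eq_mul]
    rw [this]; ring)
  refine ⟨a, w, w', hε, isSMulRegular_iff_right_eq_zero_of_smul.2 fun b hb => ?_, hw, hw'⟩
  have h1 : ε (b • w) = 0 := by
    rw [hε, LinearMap.smul_apply, map_smul, ← smul_assoc, hb, zero_smul]
  obtain ⟨t, ht⟩ := (hex _).1 h1
  refine hw.right_eq_zero_of_smul ?_
  rw [smul_eq_mul, mul_comm, ← smul_eq_mul, ← map_smul, ← ht]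
  exact LinearMap.congr_fun (maximalMinors_comp φ) t

end HilbertBurch

section Grade

variable {R : Type*} [CommRing R]

lemma isWeaklyRegular_self_iff {rs : List R} : IsWeaklyRegular R rs ↔
    ∀ i (h : i < rs.length) (c : R), rs[i] * c ∈ Ideal.ofList (rs.take i) →
      c ∈ Ideal.ofList (rs.take i) := by
  simp only [isWeaklyRegular_iff, isSMulRegular_quotient_iff_mem_of_smul_mem, smul_eq_mul,
    Ideal.mul_top]

lemma isWeaklyRegular_pair {x y : R} (hx : IsSMulRegular R x)
    (hy : IsSMulRegular (R ⧸ Ideal.span {x}) y) : IsWeaklyRegular R [x, y] := by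
  rw [isWeaklyRegular_self_iff]
  intro i hi c hc
  match i, hi with
  | 0, _ =>
    simp only [List.take_zero, Ideal.ofList_nil, Ideal.mem_bot] at hc ⊢
    exact hx.right_eq_zero_of_smul hc
  | 1, _ =>
    simp only [List.take_succ_cons, List.take_zero, Ideal.ofList_singleton] at hc ⊢
    exact (isSMulRegular_quotient_iff_mem_of_smul_mem _ _).1 hy c hc

/-- The maps `s` form a contracting homotopy for multiplication by `ε t`. -/
lemma exists_homotopy {m n : ℕ} {φ : (Fin m → R) →ₗ[R] (Fin n → R)}
    {ε : (Fin n → R) →ₗ[R] R} (hφ : Function.Injective φ) (hex : Function.Exact φ ε)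
    (t : Fin n → R) : ∃ s : (Fin n → R) →ₗ[R] (Fin m → R),
      (∀ v, φ (s v) = ε t • v - ε v • t) ∧ ∀ u, s (φ u) = ε t • u := by
  let g : (Fin n → R) →ₗ[R] (Fin n → R) := ε t • LinearMap.id - ε.smulRight t
  have hg (v) : g v ∈ LinearMap.range φ := (hex _).1 (by simp [g, mul_comm])
  have hs (v) : φ ((LinearEquiv.ofInjective φ hφ).symm (g.codRestrict _ hg v)) =
      ε t • v - ε v • t :=
    congrArg Subtype.val ((LinearEquiv.ofInjective φ hφ).apply_symm_apply (g.codRestrict _ hg v))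
  refine ⟨(LinearEquiv.ofInjective φ hφ).symm ∘ₗ g.codRestrict _ hg, hs, fun u => hφ ?_⟩
  rw [LinearMap.comp_apply]
  refine (hs (φ u)).trans ?_
  rw [hex.apply_apply_eq_zero, zero_smul, sub_zero, map_smul]

/-- If the image of `ε` contains a regular sequence of length three, then every functional on the
kernel of `ε` extends. -/
lemma exists_comp_eq_of_exact {m n : ℕ} {φ : (Fin m → R) →ₗ[R] (Fin n → R)}
    {ε : (Fin n → R) →ₗ[R] R} (hφ : Function.Injective φ) (hex : Function.Exact φ ε)
    {t₁ t₂ t₃ : Fin n → R} (h₁ : IsSMulRegular R (ε t₁))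
    (h₃ : ∀ c, ε t₃ * c ∈ Ideal.span {ε t₁, ε t₂} → c ∈ Ideal.span {ε t₁, ε t₂})
    (h₂ : ∀ c, ε t₂ * c ∈ Ideal.span {ε t₁} → c ∈ Ideal.span {ε t₁})
    (u : (Fin m → R) →ₗ[R] R) : ∃ v : (Fin n → R) →ₗ[R] R, v ∘ₗ φ = u := by
  obtain ⟨s₁, -, hs₁⟩ := exists_homotopy hφ hex t₁
  obtain ⟨s₂, hs₂, -⟩ := exists_homotopy hφ hex t₂
  have key (w) : ε t₂ * u (s₁ w) = ε t₁ * u (s₂ w) + u (s₁ t₂) * ε w := by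
    have := congrArg (fun z => u (s₁ z)) (hs₂ w)
    simp only [hs₁, map_sub, map_smul, smul_eq_mul] at this
    rw [this]; ring
  obtain ⟨d, e, hde⟩ := Ideal.mem_span_pair.1 (h₃ (u (s₁ t₂))
    (Ideal.mem_span_pair.2 ⟨-u (s₂ t₃), u (s₁ t₃), by linear_combination key t₃⟩))
  have h (w) : ε t₁ ∣ u (s₁ w) - e * ε w := by
    refine Ideal.mem_span_singleton.1 (h₂ _ (Ideal.mem_span_singleton.2 ⟨u (s₂ w) + d * ε w, ?_⟩))
    linear_combination key w - ε w * hde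
  choose f hf using fun i => h (Pi.single i 1)
  refine ⟨(Pi.basisFun R (Fin n)).constr R f, LinearMap.ext fun x => h₁ ?_⟩
  have hv : u ∘ₗ s₁ = e • ε + ε t₁ • (Pi.basisFun R (Fin n)).constr R f := by
    refine (Pi.basisFun R (Fin n)).ext fun i => ?_
    simp only [LinearMap.add_apply, LinearMap.smul_apply, Module.Basis.constr_basis]
    simp only [Pi.basisFun_apply, LinearMap.comp_apply, smul_eq_mul]
    linear_combination hf i
  have := LinearMap.congr_fun hv (φ x)
  simp only [LinearMap.comp_apply, hs₁, map_smul, LinearMap.add_apply, LinearMap.smul_apply,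
    hex.apply_apply_eq_zero, smul_zero, zero_add] at this
  exact this.symm

lemma two_le_height {x y : R} (hx : IsSMulRegular R x)
    (hy : IsSMulRegular (R ⧸ Ideal.span {x}) y) {p : Ideal R} [p.IsPrime] (hxp : x ∈ p)
    (hyp : y ∈ p) : 2 ≤ p.height := by
  obtain ⟨q, hq, hqp⟩ := Ideal.exists_minimalPrimes_le ((Ideal.span_singleton_le_iff_mem p).2 hxp)
  have := hq.1.1
  have hxq : x ∈ q := hq.1.2 (Ideal.mem_span_singleton_self x)
  have h1 : q.height ≠ 0 := fun h => by
    refine hx.notMem_of_mem_minimalPrimes (p := q) ?_ hxq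
    rw [Module.annihilator_eq_bot.2 inferInstance]
    exact Ideal.height_eq_zero_iff.1 h
  have h2 : y ∉ q := hy.notMem_of_mem_minimalPrimes (by rwa [Ideal.annihilator_quotient])
  have h3 : q < p := lt_of_le_of_ne hqp fun h => h2 (h ▸ hyp)
  have h4 := Ideal.height_add_one_le_of_lt_of_isPrime h3
  refine le_trans ?_ h4
  rw [← one_add_one_eq_two]
  gcongr
  exact Order.one_le_iff_ne_zero.2 h1

/-- A multiple by a nonunit of an ideal of grade at least two is not unmixed. -/
lemma exists_associatedPrimes_height_lt [IsNoetherianRing R] {I J : Ideal R} {a x y : R}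
    (ha : IsSMulRegular R a) (ha' : ¬ IsUnit a) (hJ : J ≠ ⊤) (hI : ∀ z, z ∈ I ↔ ∃ w ∈ J, z = a * w)
    (hx : IsSMulRegular R x) (hy : IsSMulRegular (R ⧸ Ideal.span {x}) y) (hxJ : x ∈ J)
    (hyJ : y ∈ J) : ∃ p q : PrimeSpectrum R, p.asIdeal ∈ associatedPrimes R (R ⧸ I) ∧
      q.asIdeal ∈ associatedPrimes R (R ⧸ I) ∧ p.asIdeal.height < q.asIdeal.height := by
  obtain ⟨M, hM, haM⟩ := exists_max_ideal_of_mem_nonunits ha'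
  obtain ⟨p, hp, -⟩ := Ideal.exists_minimalPrimes_le ((Ideal.span_singleton_le_iff_mem M).2 haM)
  have hp' := hp.1.1
  have hp1 := Ideal.height_le_one_of_isPrincipal_of_mem_minimalPrimes _ p hp
  have hJp : ¬ J ≤ p := fun h =>
    absurd ((two_le_height hx hy (h hxJ) (h hyJ)).trans hp1) (by decide)
  have hpI : p ∈ I.minimalPrimes := by
    refine ⟨⟨hp', fun z hz => ?_⟩, fun q ⟨hq, hIq⟩ hqp => hp.2 ⟨hq, ?_⟩ hqp⟩
    · obtain ⟨w, -, rfl⟩ := (hI z).1 hz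
      exact p.mul_mem_right _ (hp.1.2 (Ideal.mem_span_singleton_self a))
    · rw [Ideal.span_singleton_le_iff_mem]
      obtain ⟨w, hw, hwp⟩ := SetLike.not_le_iff_exists.1 hJp
      exact (hq.mem_or_mem (hIq ((hI _).2 ⟨w, hw, rfl⟩))).resolve_right fun h => hwp (hqp h)
  have : Nontrivial (R ⧸ J) := Ideal.Quotient.nontrivial_iff.2 hJ
  obtain ⟨q, hq⟩ := associatedPrimes.nonempty R (R ⧸ J)
  obtain ⟨hq', z, hz⟩ := isAssociatedPrime_iff.1 hq
  obtain ⟨z, rfl⟩ := Ideal.Quotient.mk_surjective z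
  have mem_colon (K : Ideal R) (z r : R) :
      r ∈ (⊥ : Submodule R (R ⧸ K)).colon {Ideal.Quotient.mk K z} ↔ r * z ∈ K := by
    rw [Submodule.mem_colon_singleton, Submodule.mem_bot, ← Ideal.Quotient.eq_zero_iff_mem]
    rfl
  have hJq : J ≤ q := fun r hr => by rw [hz, mem_colon]; exact J.mul_mem_right _ hr
  refine ⟨⟨p, hp'⟩, ⟨q, hq'⟩, ?_, ?_, ?_⟩
  · apply Module.associatedPrimes.minimalPrimes_annihilator_subset_associatedPrimes R (R ⧸ I)
    rwa [Ideal.annihilator_quotient]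
  · refine isAssociatedPrime_iff.2 ⟨hq', Ideal.Quotient.mk I (a * z), ?_⟩
    ext r
    rw [mem_colon, hI]
    change r ∈ q ↔ _
    rw [hz, mem_colon]
    refine ⟨fun h => ⟨_, h, by ring⟩, fun ⟨w, hw, h⟩ => ?_⟩
    have : r * z = w := ha (by simp only [smul_eq_mul]; rw [← h]; ring)
    rwa [this]
  · exact hp1.trans_lt (lt_of_lt_of_le (by decide) (two_le_height hx hy (hJq hxJ) (hJq hyJ)))

lemma length_le_two_of_exact {R : Type} [CommRing R] [IsLocalRing R] {m n : ℕ} (hm : m ≠ 0)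
    {φ : (Fin m → R) →ₗ[R] (Fin n → R)} {ε : (Fin n → R) →ₗ[R] R} (hφ : Function.Injective φ)
    (hex : Function.Exact φ ε) (hmin : LinearMap.range φ ≤ maximalIdeal R • ⊤) {rs : List R}
    (hrs : IsWeaklyRegular R rs) (h : ∀ x ∈ rs, x ∈ LinearMap.range ε) : rs.length ≤ 2 := by
  match rs, hrs, h with
  | [], _, _ | [_], _, _ | [_, _], _, _ => simp
  | x₁ :: x₂ :: x₃ :: l, hrs, h =>
    obtain ⟨t₁, rfl⟩ := h x₁ (by simp)
    obtain ⟨t₂, rfl⟩ := h x₂ (by simp)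
    obtain ⟨t₃, rfl⟩ := h x₃ (by simp)
    rw [isWeaklyRegular_self_iff] at hrs
    have h₁ : ∀ c, ε t₁ * c = 0 → c = 0 := by
      have := hrs 0 (by simp)
      simpa using this
    have h₂ : ∀ c, ε t₂ * c ∈ Ideal.span {ε t₁} → c ∈ Ideal.span {ε t₁} := by
      have := hrs 1 (by simp)
      simpa using this
    have h₃ : ∀ c, ε t₃ * c ∈ Ideal.span {ε t₁, ε t₂} → c ∈ Ideal.span {ε t₁, ε t₂} := by
      have := hrs 2 (by simp)
      rw [Set.pair_comm]
      simpa [Ideal.ofList_cons, ← Ideal.span_union] using this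
    choose v hv using exists_comp_eq_of_exact hφ hex
      (isSMulRegular_iff_right_eq_zero_of_smul.2 h₁) h₃ h₂
    refine absurd (eq_zero_of_retraction φ (LinearMap.pi fun j => v (LinearMap.proj j)) ?_ hmin) hm
    exact LinearMap.ext fun x => funext fun j => LinearMap.congr_fun (hv (LinearMap.proj j)) x

lemma length_le_one_of_forall_dvd [IsLocalRing R] {a : R} (ha : ¬ IsUnit a) {rs : List R}
    (hrs : IsWeaklyRegular R rs) (h : ∀ x ∈ rs, a ∣ x) : rs.length ≤ 1 := by
  match rs, hrs, h with
  | [], _, _ | [_], _, _ => simp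
  | x₁ :: x₂ :: l, hrs, h =>
    obtain ⟨y₁, rfl⟩ := h x₁ (by simp)
    obtain ⟨y₂, rfl⟩ := h x₂ (by simp)
    rw [isWeaklyRegular_self_iff] at hrs
    have h₁ : ∀ c, a * y₁ * c = 0 → c = 0 := by
      have := hrs 0 (by simp)
      simpa using this
    have h₂ : a * y₁ ∣ a * y₂ * y₁ → a * y₁ ∣ y₁ := by
      have := hrs 1 (by simp) y₁
      simpa [Ideal.mem_span_singleton] using this
    obtain ⟨t, ht⟩ := h₂ ⟨y₂, by ring⟩
    have hu : IsUnit (1 - a * t) := (IsLocalRing.isUnit_or_isUnit_one_sub_self _).resolve_left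
      fun h => ha (isUnit_of_mul_isUnit_left h)
    have hy : y₁ = 0 := hu.mul_left_eq_zero.1 (by linear_combination ht)
    exact absurd (h₁ 1 (by simp [hy])) one_ne_zero

end Grade

theorem stmt8 (R : Type) [CommRing R] [IsNoetherianRing R] [IsLocalRing R]
    (hGor : IsGorensteinLocalRing R)
    (I : Ideal R) (b0 b1 : ℕ) (hb0 : HasBetti R (ModuleCat.of R I) 0 b0)
    (hb1 : HasBetti R (ModuleCat.of R I) 1 b1)
    (hdiff : (b1 : ℤ) - (b0 : ℤ) = -1) (hb1ne : b1 ≠ 0) :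
    ProjDimEq R (ModuleCat.of R I) 1 ∧
      ((GradeEq R I 2 ∧ ProjDimEq R (ModuleCat.of R (R ⧸ I)) 2) ∨
        (¬ (∀ p q : PrimeSpectrum R, p.asIdeal ∈ associatedPrimes R (R ⧸ I) →
            q.asIdeal ∈ associatedPrimes R (R ⧸ I) →
            ringKrullDim (Localization.AtPrime p.asIdeal) =
              ringKrullDim (Localization.AtPrime q.asIdeal)) ∧
          GradeEq R I 1)) := by
  obtain rfl : b0 = b1 + 1 := by omega
  obtain ⟨ε, φ, hε, hex, hmin⟩ := exists_minimal_presentation I hb0 hb1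
  have hex' : Function.Exact φ (I.subtype ∘ₗ ε) := fun v => by
    rw [← hex v, LinearMap.comp_apply]
    exact Submodule.coe_eq_zero
  have hrange (z : R) : z ∈ I ↔ ∃ v, (I.subtype ∘ₗ ε) v = z := by
    refine ⟨fun hz => ?_, ?_⟩
    · obtain ⟨v, hv⟩ := hε ⟨z, hz⟩
      exact ⟨v, congrArg Subtype.val hv⟩
    · rintro ⟨v, rfl⟩
      exact (ε v).2
  have hφ : Function.Injective φ := injective_of_exact_of_associatedPrimes_subset
    (fun p => mem_minimalPrimes_of_mem_associatedPrimes_of_isCMLocalRing hGor.1) hex'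
  refine ⟨projDimEq_one hb1ne ε φ hφ hε hex hmin, ?_⟩
  obtain ⟨a, w, w', haε, ha, hw, hw'⟩ := exists_eq_smul_maximalMinors hφ hex'
  have hmax := maximalMinors_mem_maximalIdeal φ hb1ne hmin
  by_cases hunit : IsUnit a
  · left
    have hI (v) : maximalMinors φ v ∈ I := by
      obtain ⟨b, hb⟩ := hunit.exists_left_inv
      refine (hrange _).2 ⟨b • v, ?_⟩
      rw [haε, map_smul, LinearMap.smul_apply, smul_smul, hb, one_smul]
    refine ⟨⟨⟨[maximalMinors φ w, maximalMinors φ w'], rfl, by simp [hI], ?_⟩, ?_⟩,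
      projDimEq_two hb1ne I ε φ hφ hε hex hmin⟩
    · exact (IsLocalRing.isRegular_iff_isWeaklyRegular_of_subset_maximalIdeal
        (List.forall_mem_cons.2 ⟨hmax w, List.forall_mem_singleton.2 (hmax w')⟩)).2
        (isWeaklyRegular_pair hw hw')
    · exact fun rs hrs h => length_le_two_of_exact hb1ne hφ hex' hmin h.toIsWeaklyRegular
        fun x hx => (hrange x).1 (hrs x hx)
  · right
    have hI (z) : z ∈ I ↔ ∃ x ∈ LinearMap.range (maximalMinors φ), z = a * x := by
      simp only [hrange, haε, LinearMap.mem_range, exists_exists_eq_and]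
      exact exists_congr fun v => eq_comm
    have hJ : LinearMap.range (maximalMinors φ) ≠ ⊤ := fun h => by
      obtain ⟨v, hv⟩ := LinearMap.range_eq_top.1 h 1
      exact (Ideal.ne_top_iff_one _).1 (maximalIdeal.isMaximal R).ne_top (hv ▸ hmax v)
    refine ⟨fun H => ?_, ⟨[a * maximalMinors φ w], rfl, ?_, ?_⟩, ?_⟩
    · obtain ⟨p, q, hp, hq, hlt⟩ := exists_associatedPrimes_height_lt ha hunit hJ hI hw hw'
        ⟨w, rfl⟩ ⟨w', rfl⟩
      have := H p q hp hq
      rw [IsLocalization.AtPrime.ringKrullDim_eq_height p.asIdeal,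
        IsLocalization.AtPrime.ringKrullDim_eq_height q.asIdeal] at this
      exact hlt.ne (WithBot.coe_injective this)
    · simpa using (hI _).2 ⟨_, ⟨w, rfl⟩, rfl⟩
    · refine (IsLocalRing.isRegular_iff_isWeaklyRegular_of_subset_maximalIdeal
        (by simpa using Ideal.mul_mem_left _ a (hmax w))).2 ?_
      exact (isWeaklyRegular_cons_iff _ _ _).2 ⟨ha.mul hw, IsWeaklyRegular.nil _ _⟩
    · exact fun rs hrs h => length_le_one_of_forall_dvd hunit h.toIsWeaklyRegular fun x hx => by
        obtain ⟨y, -, rfl⟩ := (hI x).1 (hrs x hx)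
        exact dvd_mul_right a y
end
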